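/- arXiv:1510.02032 — 3 statements merged into one kernel-verified Lean document; each statement's English description precedes it below -/
import Mathlib

section
/- For all integers k ≥ 2 and n ≥ k+1 there exists q₀ such that for every prime power q ≥ q₀ the following holds: for every (n,k,k) linear exact-repair regeneration code W_1,…,W_n with parameters (α,β,F) = (k, k−1, k²−1) over 𝔽_q on an ambient space 𝓕, there exists a subspace W_⋆ ⊆ 𝓕 with dim W_⋆ ≤ k such that W_1,…,W_n,W_⋆ form an (n+1,k,k) linear exact-repair regeneration code with the same parameters (k, k−1, k²−1) on 𝓕. -/
/-- An `(card ι, k, d)` linear exact-repair regeneration code with parameters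
`(α, β, F)` over a field `K`: an `F`-dimensional ambient space `V` with node
subspaces `W i` of dimension at most `α`, such that any `k` nodes span `V`
(data recovery), and any node can be repaired from any `d` other nodes, each
contributing a subspace of dimension at most `β` (node repair). -/
def IsERCode {K : Type} [Field K] {V : Type} [AddCommGroup V] [Module K V]
    {ι : Type} (k d α β F : ℕ) (W : ι → Submodule K V) : Prop :=
  FiniteDimensional K V ∧
  Module.finrank K V = F ∧
  (∀ i, Module.finrank K (W i) ≤ α) ∧
  (∀ A : Finset ι, A.card = k → ∑ j ∈ A, W j = ⊤) ∧
  (∀ (x : ι) (A : Finset ι), x ∉ A → A.card = d →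
    ∃ S : ι → Submodule K V,
      (∀ j ∈ A, S j ≤ W j ∧ Module.finrank K (S j) ≤ β) ∧
      W x ≤ ∑ j ∈ A, S j)

/-- Append a new node `Wst` to the family `W`, giving a family indexed by `Option ι`. -/
def extendCode {K : Type} [Field K] {V : Type} [AddCommGroup V] [Module K V]
    {ι : Type} (W : ι → Submodule K V) (Wst : Submodule K V) :
    Option ι → Submodule K V :=
  fun o => o.elim Wst W

section SubmoduleSums

variable {K V ι : Type*} [Field K] [AddCommGroup V] [Module K V]

theorem Submodule.mem_sum_of_forall_mem {A : Finset ι} {W : ι → Submodule K V} {v : ι → V}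
    (h : ∀ j ∈ A, v j ∈ W j) : ∑ j ∈ A, v j ∈ ∑ j ∈ A, W j := by
  classical
  induction A using Finset.induction_on with
  | empty => simp
  | insert a s ha ih =>
    rw [Finset.sum_insert ha, Finset.sum_insert ha]
    exact Submodule.add_mem_sup (h a (by simp)) (ih fun j hj => h j (by simp [hj]))

theorem Submodule.exists_sum_of_mem_sum {A : Finset ι} {W : ι → Submodule K V} {x : V}
    (hx : x ∈ ∑ j ∈ A, W j) : ∃ v : ι → V, (∀ j ∈ A, v j ∈ W j) ∧ ∑ j ∈ A, v j = x := by
  classical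
  induction A using Finset.induction_on generalizing x with
  | empty => exact ⟨0, by simp, by simpa using hx.symm⟩
  | insert a s ha ih =>
    rw [Finset.sum_insert ha] at hx
    obtain ⟨y, hy, z, hz, rfl⟩ := Submodule.mem_sup.1 hx
    obtain ⟨v, hv, rfl⟩ := ih hz
    have hne : ∀ j ∈ s, j ≠ a := fun j hj h => ha (h ▸ hj)
    refine ⟨Function.update v a y, ?_, ?_⟩
    · intro j hj
      rcases Finset.mem_insert.1 hj with rfl | hj
      · simpa using hy
      · rw [Function.update_of_ne (hne j hj)]
        exact hv j hj
    · rw [Finset.sum_insert ha, Function.update_self]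
      congr 1
      exact Finset.sum_congr rfl fun j hj => Function.update_of_ne (hne j hj) _ _

theorem Submodule.sum_le_sum_of_le {A : Finset ι} {W S : ι → Submodule K V}
    (h : ∀ j ∈ A, S j ≤ W j) : ∑ j ∈ A, S j ≤ ∑ j ∈ A, W j := by
  intro x hx
  obtain ⟨v, hv, rfl⟩ := Submodule.exists_sum_of_mem_sum hx
  exact Submodule.mem_sum_of_forall_mem fun j hj => h j hj (hv j hj)

theorem Submodule.finrank_sum_le [FiniteDimensional K V] (A : Finset ι) (W : ι → Submodule K V) :
    Module.finrank K ↥(∑ j ∈ A, W j) ≤ ∑ j ∈ A, Module.finrank K (W j) := by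
  classical
  induction A using Finset.induction_on with
  | empty => exact (finrank_bot K V).le
  | insert a s ha ih =>
    rw [Finset.sum_insert ha, Finset.sum_insert ha]
    exact (Submodule.finrank_add_le_finrank_add_finrank _ _).trans (by gcongr)

end SubmoduleSums

section Transfer

variable {K : Type} [Field K] {V : Type} [AddCommGroup V] [Module K V] {ι κ : Type}
  {k d α β F : ℕ}

theorem IsERCode.comp {W : ι → Submodule K V} (h : IsERCode k d α β F W) {f : κ → ι}
    (hf : Function.Injective f) : IsERCode k d α β F (W ∘ f) := by
  obtain ⟨h1, h2, h3, h4, h5⟩ := h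
  let e : κ ↪ ι := ⟨f, hf⟩
  refine ⟨h1, h2, fun i => h3 _, fun A hA => ?_, fun x A hx hA => ?_⟩
  · rw [← h4 (A.map e) (by simpa using hA), Finset.sum_map]
    rfl
  · obtain ⟨S, hS, hW⟩ := h5 (f x) (A.map e) (by simpa [e, hf.eq_iff] using hx) (by simpa using hA)
    refine ⟨S ∘ f, fun j hj => hS (f j) (Finset.mem_map_of_mem e hj), ?_⟩
    rwa [Finset.sum_map] at hW

theorem isERCode_of_forall_restrict [Fintype ι] (hι : k < Fintype.card ι)
    {W : ι → Submodule K V}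
    (h : ∀ s : Finset ι, s.card = k + 1 → IsERCode k k α β F fun j : s => W j) :
    IsERCode k k α β F W := by
  classical
  have ext (A : Finset ι) (hA : A.card = k) : ∃ x, x ∉ A := by
    by_contra! hc
    rw [Finset.eq_univ_of_forall hc, Finset.card_univ] at hA
    omega
  have sums (s A : Finset ι) (hAs : A ⊆ s) (S : ι → Submodule K V) :
      ∑ j ∈ A.subtype (· ∈ s), S j = ∑ j ∈ A, S j :=
    Finset.sum_subtype_of_mem S fun j hj => hAs hj
  have cards (s A : Finset ι) (hAs : A ⊆ s) : (A.subtype (· ∈ s)).card = A.card := by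
    rw [Finset.card_subtype, Finset.filter_true_of_mem hAs]
  obtain ⟨s₀, hs₀⟩ : ∃ s : Finset ι, s.card = k + 1 := by
    obtain ⟨s, -, hs⟩ := Finset.exists_subset_card_eq (s := (Finset.univ : Finset ι))
      (show k + 1 ≤ _ by rw [Finset.card_univ]; omega)
    exact ⟨s, hs⟩
  refine ⟨(h s₀ hs₀).1, (h s₀ hs₀).2.1, fun i => ?_, fun A hA => ?_, fun x A hx hA => ?_⟩
  · obtain ⟨s, his, -, hs⟩ := Finset.exists_subsuperset_card_eq (s := {i})
      (t := (Finset.univ : Finset ι)) (n := k + 1) (by simp) (by simp)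
      (by rw [Finset.card_univ]; omega)
    exact (h s hs).2.2.1 ⟨i, his (by simp)⟩
  · obtain ⟨x, hx⟩ := ext A hA
    have hAs := Finset.subset_insert x A
    rw [← sums _ A hAs]
    exact (h (insert x A) (by rw [Finset.card_insert_of_notMem hx, hA])).2.2.2.1 _
      ((cards _ A hAs).trans hA)
  · have hAs := Finset.subset_insert x A
    obtain ⟨S, hS, hW⟩ := (h (insert x A) (by rw [Finset.card_insert_of_notMem hx, hA])).2.2.2.2
      ⟨x, by simp⟩ (A.subtype (· ∈ insert x A)) (by simpa using hx) ((cards _ A hAs).trans hA)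
    obtain ⟨S', hS'⟩ : ∃ S' : ι → Submodule K V, ∀ j : ↥(insert x A), S' j = S j :=
      ⟨fun j => if hj : j ∈ insert x A then S ⟨j, hj⟩ else ⊥, fun j => dif_pos j.2⟩
    refine ⟨S', fun j hj => ?_, ?_⟩
    · rw [hS' ⟨j, hAs hj⟩]
      exact hS ⟨j, hAs hj⟩ (by simpa using hj)
    · rw [← sums _ A hAs]
      simpa [hS'] using hW

end Transfer

section Injectivity

open Polynomial

variable {K X Y : Type*} [Field K] [AddCommGroup X] [Module K X] [AddCommGroup Y] [Module K Y]

theorem Polynomial.natDegree_det_le {R n : Type*} [CommRing R] [Fintype n] [DecidableEq n]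
    {M : Matrix n n R[X]} {d : ℕ} (h : ∀ i j, (M i j).natDegree ≤ d) :
    M.det.natDegree ≤ Fintype.card n * d := by
  rw [Matrix.det_apply]
  refine natDegree_sum_le_of_forall_le _ _ fun σ _ => ?_
  refine (natDegree_smul_le _ _).trans ((natDegree_prod_le _ _).trans ?_)
  refine (Finset.sum_le_card_nsmul _ _ d fun i _ => h _ _).trans ?_
  simp

/-- Injectivity is an open condition along a polynomial curve of linear maps. -/
theorem LinearMap.exists_polynomial_injective_of_eval_ne_zero [FiniteDimensional K X]
    {ι : Type*} [Fintype ι] (f : K → X →ₗ[K] Y) (g : X →ₗ[K] Y) (h : ι → X →ₗ[K] Y)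
    (p : ι → K[X]) (d : ℕ) (hp : ∀ i, (p i).natDegree ≤ d)
    (hf : ∀ t, f t = g + ∑ i, (p i).eval t • h i) {t₀ : K} (h₀ : Function.Injective (f t₀)) :
    ∃ P : K[X], P ≠ 0 ∧ P.natDegree ≤ Module.finrank K X * d ∧
      ∀ t, P.eval t ≠ 0 → Function.Injective (f t) := by
  classical
  obtain ⟨L, hL⟩ := (f t₀).exists_leftInverse_of_injective (LinearMap.ker_eq_bot.2 h₀)
  let b := Module.finBasis K X
  let τ := LinearMap.toMatrix b b
  let M : Matrix (Fin (Module.finrank K X)) (Fin (Module.finrank K X)) K[X] :=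
    fun a c => C (τ (L ∘ₗ g) a c) + ∑ i, p i * C (τ (L ∘ₗ h i) a c)
  have hM (t : K) : M.det.eval t = LinearMap.det (L ∘ₗ f t) := by
    rw [← LinearMap.det_toMatrix b, ← Polynomial.coe_evalRingHom, RingHom.map_det]
    congr 1
    have hsum : L ∘ₗ f t = L ∘ₗ g + ∑ i, (p i).eval t • (L ∘ₗ h i) := by
      ext x
      simp [hf]
    change _ = τ (L ∘ₗ f t)
    rw [hsum, map_add, map_sum]
    ext a c
    change (M a c).eval t = _
    simp [M, eval_finsetSum, Matrix.sum_apply]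
  refine ⟨M.det, ?_, ?_, fun t ht => ?_⟩
  · intro hz
    have := hM t₀
    rw [hz, hL] at this
    simp at this
  · refine (natDegree_det_le (d := d) fun a c => ?_).trans (by simp)
    refine natDegree_add_le_of_degree_le (by simp) (natDegree_sum_le_of_forall_le _ _ fun i _ => ?_)
    exact (natDegree_mul_C_le _ _).trans (hp i)
  · rw [hM] at ht
    have hu := (LinearMap.isUnit_iff_isUnit_det (L ∘ₗ f t)).2 ht.isUnit
    have hi : Function.Injective (L ∘ₗ f t) := (Module.End.isUnit_iff _).1 hu |>.1
    exact Function.Injective.of_comp (f := L) (by simpa using hi)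

end Injectivity

section Relations

variable {K : Type} [Field K] {V E N : Type} [AddCommGroup V] [Module K V] [AddCommGroup E]
  [Module K E] [Fintype N] {k : ℕ}

/-- The map `(ρ j)ⱼ ↦ ∑ⱼ b j (ρ j)`, whose kernel is the space of relations between the nodes
parametrized by the maps `b j`. -/
def relationMap (b : N → E →ₗ[K] V) : (N → E) →ₗ[K] V :=
  ∑ j, b j ∘ₗ LinearMap.proj j

@[simp]
theorem relationMap_apply (b : N → E →ₗ[K] V) (ρ : N → E) :
    relationMap b ρ = ∑ j, b j (ρ j) := by
  simp [relationMap]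

/-- The kernel of this map is the space of relations which do not involve the node `j`. -/
def pinnedMap (b : N → E →ₗ[K] V) (j : N) : (N → E) →ₗ[K] V × E :=
  (relationMap b).prod (LinearMap.proj j)

@[simp]
theorem pinnedMap_apply (b : N → E →ₗ[K] V) (j : N) (ρ : N → E) :
    pinnedMap b j ρ = (∑ i, b i (ρ i), ρ j) := by
  simp [pinnedMap]

/-- This map is injective if and only if the spaces `ker (pinnedMap b j)` are independent. -/
def independenceMap (b : N → E →ₗ[K] V) : (N → N → E) →ₗ[K] (N → V × E) × (N → E) :=
  (LinearMap.pi fun j => pinnedMap b j ∘ₗ LinearMap.proj j).prod (∑ j, LinearMap.proj j)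

@[simp]
theorem independenceMap_apply (b : N → E →ₗ[K] V) (ρ : N → N → E) :
    independenceMap b ρ = (fun j => pinnedMap b j (ρ j), ∑ j, ρ j) := by
  ext <;> simp [independenceMap]

theorem independenceMap_injective_iff (b : N → E →ₗ[K] V) :
    Function.Injective (independenceMap b) ↔
      ∀ ρ : N → N → E, (∀ j, pinnedMap b j (ρ j) = 0) → ∑ j, ρ j = 0 → ρ = 0 := by
  rw [injective_iff_map_eq_zero]
  refine forall_congr' fun ρ => ?_
  rw [independenceMap_apply, Prod.mk_eq_zero, and_imp, funext_iff]
  rfl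

variable [FiniteDimensional K V] [FiniteDimensional K E]

omit [FiniteDimensional K V] in
theorem finrank_ker_relationMap (hk : 1 ≤ k) (hN : Fintype.card N = k + 1)
    (hE : Module.finrank K E = k) (hV : Module.finrank K V = k ^ 2 - 1) {b : N → E →ₗ[K] V}
    (hb : Function.Surjective (relationMap b)) :
    Module.finrank K (LinearMap.ker (relationMap b)) = k + 1 := by
  have h := (relationMap b).finrank_range_add_finrank_ker
  rw [LinearMap.range_eq_top.2 hb, finrank_top, hV, Module.finrank_pi_fintype] at h
  simp only [hE, Finset.sum_const, Finset.card_univ, hN, smul_eq_mul] at h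
  have : 1 ≤ k ^ 2 := Nat.one_le_pow _ _ hk
  have : (k + 1) * k = k ^ 2 + k := by ring
  omega

theorem finrank_range_add_finrank_ker_pinnedMap (hk : 1 ≤ k) (hN : Fintype.card N = k + 1)
    (hE : Module.finrank K E = k) (hV : Module.finrank K V = k ^ 2 - 1) (b : N → E →ₗ[K] V)
    (j : N) :
    Module.finrank K (LinearMap.range (pinnedMap b j)) +
      Module.finrank K (LinearMap.ker (pinnedMap b j)) = Module.finrank K (V × E) + 1 := by
  rw [LinearMap.finrank_range_add_finrank_ker, Module.finrank_prod, Module.finrank_pi_fintype]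
  simp only [hE, hV, Finset.sum_const, Finset.card_univ, hN, smul_eq_mul]
  have : 1 ≤ k ^ 2 := Nat.one_le_pow _ _ hk
  have : (k + 1) * k = k ^ 2 + k := by ring
  omega

theorem finrank_ker_pinnedMap_eq_one_iff (hk : 1 ≤ k) (hN : Fintype.card N = k + 1)
    (hE : Module.finrank K E = k) (hV : Module.finrank K V = k ^ 2 - 1) (b : N → E →ₗ[K] V)
    (j : N) :
    Module.finrank K (LinearMap.ker (pinnedMap b j)) = 1 ↔ Function.Surjective (pinnedMap b j) := by
  have h := finrank_range_add_finrank_ker_pinnedMap hk hN hE hV b j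
  rw [← LinearMap.range_eq_top]
  constructor
  · intro h1
    exact Submodule.eq_top_of_finrank_eq (by omega)
  · intro h1
    rw [h1, finrank_top] at h
    omega

/-- Independence of the spaces of relations forces each of them to be a line, and together
these lines span all relations. -/
theorem exists_decomposition_of_independenceMap_injective (hk : 1 ≤ k)
    (hN : Fintype.card N = k + 1) (hE : Module.finrank K E = k)
    (hV : Module.finrank K V = k ^ 2 - 1) {b : N → E →ₗ[K] V}
    (hb : Function.Surjective (relationMap b)) (hi : Function.Injective (independenceMap b)) :
    (∀ j, Module.finrank K (LinearMap.ker (pinnedMap b j)) = 1) ∧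
      ∀ σ, relationMap b σ = 0 →
        ∃ ρ : N → N → E, (∀ j, pinnedMap b j (ρ j) = 0) ∧ ∑ j, ρ j = σ := by
  classical
  rw [independenceMap_injective_iff] at hi
  have hR := finrank_ker_relationMap hk hN hE hV hb
  have hle (j : N) : LinearMap.ker (pinnedMap b j) ≤ LinearMap.ker (relationMap b) := by
    rw [pinnedMap, LinearMap.ker_prod]
    exact inf_le_left
  let Θ : (∀ j, LinearMap.ker (pinnedMap b j)) →ₗ[K] LinearMap.ker (relationMap b) :=
    ∑ j, Submodule.inclusion (hle j) ∘ₗ LinearMap.proj j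
  have hΘ (ρ) : (Θ ρ : N → E) = ∑ j, (ρ j : N → E) := by
    simp [Θ]
  have hΘi : Function.Injective Θ := by
    rw [injective_iff_map_eq_zero]
    intro ρ hρ
    have := hi (fun j => ρ j) (fun j => (ρ j).2) (by rw [← hΘ, hρ]; rfl)
    ext j : 2
    exact congrFun this j
  have hone (j : N) : 1 ≤ Module.finrank K (LinearMap.ker (pinnedMap b j)) := by
    have h := finrank_range_add_finrank_ker_pinnedMap hk hN hE hV b j
    have := Submodule.finrank_le (LinearMap.range (pinnedMap b j))
    omega
  have hsum : ∑ j, Module.finrank K (LinearMap.ker (pinnedMap b j)) ≤ k + 1 := by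
    rw [← hR, ← Module.finrank_pi_fintype]
    exact LinearMap.finrank_le_finrank_of_injective hΘi
  have hsum' : ∑ j : N, 1 = ∑ j, Module.finrank K (LinearMap.ker (pinnedMap b j)) := by
    refine le_antisymm (Finset.sum_le_sum fun j _ => hone j) (hsum.trans ?_)
    simp [hN]
  refine ⟨fun j => ?_, fun σ hσ => ?_⟩
  · exact ((Finset.sum_eq_sum_iff_of_le fun j _ => hone j).1 hsum' j (Finset.mem_univ j)).symm
  · have hΘs : Function.Surjective Θ := by
      refine (LinearMap.injective_iff_surjective_of_finrank_eq_finrank ?_).1 hΘi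
      rw [hR, Module.finrank_pi_fintype, ← hsum']
      simp [hN]
    obtain ⟨ρ, hρ⟩ := hΘs ⟨σ, hσ⟩
    exact ⟨fun j => ρ j, fun j => (ρ j).2, by rw [← hΘ, hρ]⟩

theorem eq_univ_erase_of_notMem [DecidableEq N] (hN : Fintype.card N = k + 1) {x : N}
    {A : Finset N} (hx : x ∉ A) (hA : A.card = k) : A = Finset.univ.erase x := by
  refine Finset.eq_of_subset_of_card_le (fun y hy => ?_) ?_
  · simpa using fun h : y = x => hx (h ▸ hy)
  · rw [Finset.card_erase_of_mem (Finset.mem_univ x), Finset.card_univ, hN, hA]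
    simp

theorem exists_eq_univ_erase [DecidableEq N] (hN : Fintype.card N = k + 1)
    {A : Finset N} (hA : A.card = k) : ∃ x, A = Finset.univ.erase x := by
  obtain ⟨x, hx⟩ : ∃ x, x ∉ A := by
    by_contra! hc
    rw [Finset.eq_univ_of_forall hc, Finset.card_univ] at hA
    omega
  exact ⟨x, eq_univ_erase_of_notMem hN hx hA⟩

theorem isERCode_range_of_independenceMap_injective (hk : 1 ≤ k)
    (hN : Fintype.card N = k + 1) (hE : Module.finrank K E = k)
    (hV : Module.finrank K V = k ^ 2 - 1) {b : N → E →ₗ[K] V}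
    (hb : Function.Surjective (relationMap b)) (hi : Function.Injective (independenceMap b)) :
    IsERCode k k k (k - 1) (k ^ 2 - 1) fun j => LinearMap.range (b j) := by
  classical
  obtain ⟨hone, hdec⟩ := exists_decomposition_of_independenceMap_injective hk hN hE hV hb hi
  have hsurj (j : N) := (finrank_ker_pinnedMap_eq_one_iff hk hN hE hV b j).1 (hone j)
  refine ⟨inferInstance, hV, fun j => ?_, fun A hA => ?_, fun x A hx hA => ?_⟩
  · exact (LinearMap.finrank_range_le _).trans hE.le
  · obtain ⟨x, rfl⟩ := exists_eq_univ_erase hN hA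
    rw [eq_top_iff]
    rintro v -
    obtain ⟨ρ, hρ⟩ := hsurj x (v, 0)
    rw [pinnedMap_apply, Prod.mk.injEq, ← Finset.add_sum_erase _ _ (Finset.mem_univ x)] at hρ
    rw [← hρ.1, hρ.2, map_zero, zero_add]
    exact Submodule.mem_sum_of_forall_mem fun j _ => LinearMap.mem_range_self _ _
  · obtain rfl := eq_univ_erase_of_notMem hN hx hA
    refine ⟨fun y => ∑ z ∈ (Finset.univ.erase x).erase y,
      (LinearMap.ker (pinnedMap b z)).map (b y ∘ₗ LinearMap.proj y), fun y hy => ⟨?_, ?_⟩, ?_⟩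
    · intro v hv
      obtain ⟨u, hu, rfl⟩ := Submodule.exists_sum_of_mem_sum hv
      refine Submodule.sum_mem _ fun z hz => ?_
      obtain ⟨ρ, -, hρ⟩ := hu z hz
      exact ⟨ρ y, hρ⟩
    · refine (Submodule.finrank_sum_le _ _).trans ?_
      refine (Finset.sum_le_card_nsmul _ _ 1 fun z _ => ?_).trans ?_
      · exact (Submodule.finrank_map_le _ _).trans (hone z).le
      · rw [Finset.card_erase_of_mem hy, hA]
        simp
    · rintro _ ⟨e, rfl⟩
      obtain ⟨σ, hσ⟩ := hsurj x (0, e)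
      rw [pinnedMap_apply, Prod.mk.injEq] at hσ
      obtain ⟨ρ, hρ, rfl⟩ := hdec σ (by simpa using hσ.1)
      have hρx (z : N) : ∑ i, b i (ρ z i) = 0 ∧ ρ z z = 0 := by
        simpa using hρ z
      have he : b x e = ∑ y ∈ Finset.univ.erase x, -b y (∑ z ∈ Finset.univ.erase x, ρ z y) := by
        have h1 : ∑ y, b y (∑ z ∈ Finset.univ.erase x, ρ z y) = 0 := by
          simp only [map_sum]
          rw [Finset.sum_comm]
          exact Finset.sum_eq_zero fun z _ => (hρx z).1
        rw [← Finset.add_sum_erase _ _ (Finset.mem_univ x)] at h1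
        rw [Finset.sum_neg_distrib, ← eq_neg_of_add_eq_zero_left h1, ← hσ.2, Finset.sum_apply,
          ← Finset.add_sum_erase _ _ (Finset.mem_univ x), (hρx x).2, zero_add]
      rw [he]
      refine Submodule.mem_sum_of_forall_mem fun y hy => Submodule.neg_mem _ ?_
      rw [← Finset.add_sum_erase _ _ hy, (hρx y).2, zero_add, map_sum]
      exact Submodule.mem_sum_of_forall_mem fun z _ => ⟨ρ z, hρ z, rfl⟩

omit [FiniteDimensional K V] in
theorem IsERCode.finrank_eq (hk : 2 ≤ k) (hN : Fintype.card N = k + 1) {W : N → Submodule K V}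
    (h : IsERCode k k k (k - 1) (k ^ 2 - 1) W) (i : N) : Module.finrank K (W i) = k := by
  classical
  obtain ⟨hfin, hV, hα, hrec, hrep⟩ := h
  refine le_antisymm (hα i) ?_
  by_contra! hlt
  obtain ⟨x, hx⟩ : ∃ x, x ∉ ({i} : Finset N) := by
    by_contra! hc
    have := congrArg Finset.card (Finset.eq_univ_of_forall hc)
    rw [Finset.card_univ, Finset.card_singleton] at this
    omega
  obtain ⟨y, hy⟩ : ∃ y, y ∉ ({i, x} : Finset N) := by
    by_contra! hc
    have := congrArg Finset.card (Finset.eq_univ_of_forall hc)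
    rw [Finset.card_univ, Finset.card_pair fun h => hx (by simp [h])] at this
    omega
  simp only [Finset.mem_singleton, Finset.mem_insert, not_or] at hx hy
  have hcard (z : N) : (Finset.univ.erase z).card = k := by
    rw [Finset.card_erase_of_mem (Finset.mem_univ z), Finset.card_univ, hN, Nat.add_sub_cancel]
  obtain ⟨S, hS, hW⟩ := hrep x (Finset.univ.erase x) (by simp) (hcard x)
  have hyx : y ∈ Finset.univ.erase x := by simp [hy.2]
  set B := (Finset.univ.erase x).erase y with hB
  have hiB : i ∈ B := by simp [hB, Ne.symm hx, Ne.symm hy.1]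
  have htop : (⊤ : Submodule K V) ≤ S y + ∑ z ∈ B, W z := by
    have hxy : x ∈ Finset.univ.erase y := by simp [Ne.symm hy.2]
    rw [← hrec _ (hcard y), ← Finset.add_sum_erase _ _ hxy, Finset.erase_right_comm]
    refine sup_le (hW.trans ?_) le_sup_right
    rw [← Finset.add_sum_erase _ _ hyx]
    refine sup_le_sup le_rfl (Submodule.sum_le_sum_of_le fun j hj => (hS j ?_).1)
    exact Finset.mem_of_mem_erase hj
  have h1 := (Submodule.finrank_mono htop).trans
    (Submodule.finrank_add_le_finrank_add_finrank _ _)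
  have h2 := Submodule.finrank_sum_le B W
  have h3 : ∑ j ∈ B.erase i, Module.finrank K (W j) ≤ (k - 2) * k := by
    refine (Finset.sum_le_card_nsmul _ _ k fun z _ => hα z).trans ?_
    rw [Finset.card_erase_of_mem hiB, Finset.card_erase_of_mem hyx, hcard x, smul_eq_mul]
    rfl
  rw [← Finset.add_sum_erase B (fun j => Module.finrank K (W j)) hiB] at h2
  rw [finrank_top, hV] at h1
  have h4 := (hS y hyx).2
  obtain ⟨m, rfl⟩ := Nat.exists_eq_add_of_le' hk
  have : (m + 2) ^ 2 = m * (m + 2) + 2 * m + 4 := by ring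
  simp only [Nat.add_sub_cancel] at h3
  omega

omit [FiniteDimensional K V] [FiniteDimensional K E] in
theorem IsERCode.pinnedMap_surjective (hN : Fintype.card N = k + 1) {α β F : ℕ}
    {b : N → E →ₗ[K] V} (h : IsERCode k k α β F fun j => LinearMap.range (b j)) (x : N) :
    Function.Surjective (pinnedMap b x) := by
  classical
  rintro ⟨v, e⟩
  have hx : v - b x e ∈ ∑ j ∈ Finset.univ.erase x, LinearMap.range (b j) := by
    rw [h.2.2.2.1 _ (by rw [Finset.card_erase_of_mem (Finset.mem_univ x), Finset.card_univ, hN,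
      Nat.add_sub_cancel])]
    trivial
  obtain ⟨u, hu, hsum⟩ := Submodule.exists_sum_of_mem_sum hx
  choose! c hc using hu
  refine ⟨Function.update c x e, ?_⟩
  rw [pinnedMap_apply, ← Finset.add_sum_erase _ _ (Finset.mem_univ x), Function.update_self,
    ← add_sub_cancel (b x e) v, ← hsum]
  congr 2
  refine Finset.sum_congr rfl fun j hj => ?_
  rw [Function.update_of_ne (Finset.ne_of_mem_erase hj), hc j hj]

theorem IsERCode.independenceMap_injective (hk : 2 ≤ k) (hN : Fintype.card N = k + 1)
    (hE : Module.finrank K E = k) {b : N → E →ₗ[K] V}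
    (h : IsERCode k k k (k - 1) (k ^ 2 - 1) fun j => LinearMap.range (b j)) :
    Function.Injective (independenceMap b) := by
  classical
  have hV : Module.finrank K V = k ^ 2 - 1 := h.2.1
  have hdim := h.finrank_eq hk hN
  have hsurj := h.pinnedMap_surjective hN
  have hone (j : N) := (finrank_ker_pinnedMap_eq_one_iff (by omega) hN hE hV b j).2 (hsurj j)
  have hinj (j : N) : Function.Injective (b j) := by
    have := (b j).finrank_range_add_finrank_ker
    rw [hdim j, hE] at this
    exact LinearMap.ker_eq_bot.1 (Submodule.finrank_eq_zero.1 (by omega))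
  have hcard (z : N) : (Finset.univ.erase z).card = k := by
    rw [Finset.card_erase_of_mem (Finset.mem_univ z), Finset.card_univ, hN, Nat.add_sub_cancel]
  rw [independenceMap_injective_iff]
  intro ρ hρ hsum
  ext x : 1
  by_contra! hne
  have hrel : Function.Surjective (relationMap b) := fun v => by
    obtain ⟨ρ, hρ⟩ := hsurj x (v, 0)
    exact ⟨ρ, congrArg Prod.fst hρ⟩
  have hR := finrank_ker_relationMap (by omega) hN hE hV hrel
  obtain ⟨S, hS, hW⟩ := h.2.2.2.2 x (Finset.univ.erase x) (by simp) (hcard x)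
  let T : Submodule K (N → E) := LinearMap.ker (relationMap b) ⊓
    ⨅ y ∈ Finset.univ.erase x, (S y).comap (b y ∘ₗ LinearMap.proj y)
  have hT (σ : N → E) : σ ∈ T ↔ relationMap b σ = 0 ∧
      ∀ y ∈ Finset.univ.erase x, b y (σ y) ∈ S y := by
    simp [T, Submodule.mem_iInf]
  let π (y : N) : T →ₗ[K] E := LinearMap.proj y ∘ₗ T.subtype
  have hπ : Function.Surjective (π x) := by
    intro e
    obtain ⟨u, hu, hue⟩ := Submodule.exists_sum_of_mem_sum (hW ⟨e, rfl⟩)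
    choose! c hc using fun j hj => (hS j hj).1 (hu j hj)
    have hmem : Function.update (-c) x e ∈ T := by
      have hne' (j) (hj : j ∈ Finset.univ.erase x) : Function.update (-c) x e j = -c j :=
        Function.update_of_ne (Finset.ne_of_mem_erase hj) _ _
      refine (hT _).2 ⟨?_, fun y hy => ?_⟩
      · rw [relationMap_apply, ← Finset.add_sum_erase _ _ (Finset.mem_univ x),
          Function.update_self, ← hue, ← Finset.sum_add_distrib]
        refine Finset.sum_eq_zero fun j hj => ?_
        rw [hne' j hj, map_neg, hc j hj, add_neg_cancel]
      · rw [hne' y hy, map_neg, hc y hy]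
        exact Submodule.neg_mem _ (hu y hy)
    exact ⟨⟨_, hmem⟩, by simp [π]⟩
  have hTk := (π x).finrank_range_add_finrank_ker
  rw [LinearMap.range_eq_top.2 hπ, finrank_top, hE] at hTk
  have hker (y : N) (hy : y ∈ Finset.univ.erase x) : LinearMap.ker (pinnedMap b y) ≤ T := by
    let f : T →ₗ[K] S y :=
      LinearMap.codRestrict (S y) (b y ∘ₗ π y) fun σ => ((hT σ).1 σ.2).2 y hy
    obtain ⟨σ, hσ, hσ0⟩ := (Submodule.ne_bot_iff _).1 (f.ker_ne_bot_of_finrank_lt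
      (by have := (hS y hy).2; omega))
    have hσy : (σ : N → E) y = 0 := by
      apply hinj y
      rw [map_zero]
      exact congrArg Subtype.val hσ
    have hσk : (σ : N → E) ∈ LinearMap.ker (pinnedMap b y) := by
      have := ((hT σ).1 σ.2).1
      rw [LinearMap.mem_ker, pinnedMap_apply, hσy, ← relationMap_apply, this]
      rfl
    intro τ hτ
    obtain ⟨a, ha⟩ := (finrank_eq_one_iff_of_nonzero' (⟨σ, hσk⟩ : LinearMap.ker (pinnedMap b y))
      (by simpa using hσ0)).1 (hone y) ⟨τ, hτ⟩
    rw [← show a • (σ : N → E) = τ from congrArg Subtype.val ha]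
    exact T.smul_mem a σ.2
  have hρT : ρ x ∈ T := by
    rw [← Finset.add_sum_erase _ _ (Finset.mem_univ x)] at hsum
    rw [eq_neg_of_add_eq_zero_left hsum]
    exact Submodule.neg_mem _ (Submodule.sum_mem _ fun y hy => hker y hy (hρ y))
  have hpos : 0 < Module.finrank K (LinearMap.ker (π x)) := by
    refine Nat.pos_of_ne_zero fun h0 => hne ?_
    have hρk : (⟨ρ x, hρT⟩ : T) ∈ LinearMap.ker (π x) := congrArg Prod.snd (hρ x)
    rw [Submodule.finrank_eq_zero.1 h0, Submodule.mem_bot] at hρk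
    exact congrArg Subtype.val hρk
  have hTR : T = LinearMap.ker (relationMap b) :=
    Submodule.eq_of_le_of_finrank_le inf_le_left (by omega)
  obtain ⟨y, hy⟩ : (Finset.univ.erase x).Nonempty := Finset.card_pos.1 (by rw [hcard]; omega)
  have hWS : LinearMap.range (b y) ≤ S y := by
    rintro _ ⟨e, rfl⟩
    obtain ⟨σ, hσ⟩ := hsurj y (0, e)
    have hσT : σ ∈ T := by
      rw [hTR]
      exact congrArg Prod.fst hσ
    rw [← show σ y = e from congrArg Prod.snd hσ]
    exact ((hT σ).1 hσT).2 y hy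
  have h1 := Submodule.finrank_mono hWS
  have h2 := (hS y hy).2
  have h3 := hdim y
  omega

omit [FiniteDimensional K V] [FiniteDimensional K E] in
theorem range_le_range_relationMap (b : N → E →ₗ[K] V) (j : N) :
    LinearMap.range (b j) ≤ LinearMap.range (relationMap b) := by
  classical
  rintro _ ⟨e, rfl⟩
  refine ⟨Pi.single j e, ?_⟩
  rw [relationMap_apply, Finset.sum_eq_single j]
  · rw [Pi.single_eq_same]
  · intro i _ hi
    rw [Pi.single_eq_of_ne hi, map_zero]
  · simp

end Relations

section Extension

open Polynomial

variable {K : Type} [Field K] {V E : Type} [AddCommGroup V] [Module K V] [AddCommGroup E]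
  [Module K E] {k n : ℕ}

/-- Append a parametrized node `β` to the family `b`. -/
def extendMaps (b : Fin n → E →ₗ[K] V) (β : E →ₗ[K] V) : Option (Fin n) → E →ₗ[K] V :=
  fun o => o.elim β b

theorem extendCode_range (b : Fin n → E →ₗ[K] V) (β : E →ₗ[K] V) :
    extendCode (fun i => LinearMap.range (b i)) (LinearMap.range β) =
      fun o => LinearMap.range (extendMaps b β o) := by
  ext1 o
  cases o <;> rfl

theorem independenceMap_extendMaps_sum (b : Fin n → E →ₗ[K] V) (s : Finset (Option (Fin n)))
    (c : Fin n → K) :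
    independenceMap (fun j : s => extendMaps b (∑ i, c i • b i) j) =
      independenceMap (fun j : s => extendMaps b 0 j) + ∑ i, c i •
        (LinearMap.pi fun j => ((relationMap fun o : s => extendMaps (0 : Fin n → E →ₗ[K] V) (b i) o).prod 0) ∘ₗ
          LinearMap.proj j).prod (0 : (s → s → E) →ₗ[K] (s → E)) := by
  refine LinearMap.ext fun ρ => ?_
  have key (j : s) : ∑ o : s, extendMaps b (∑ i, c i • b i) o (ρ j o) =
      ∑ o : s, extendMaps b 0 o (ρ j o) +
        ∑ i, c i • ∑ o : s, extendMaps (0 : Fin n → E →ₗ[K] V) (b i) o (ρ j o) := by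
    simp only [Finset.smul_sum]
    rw [Finset.sum_comm, ← Finset.sum_add_distrib]
    refine Finset.sum_congr rfl fun o _ => ?_
    rcases o with ⟨_ | o, ho⟩ <;> simp [extendMaps]
  ext j
  · simpa [Prod.fst_sum, Finset.sum_apply] using key j
  · simp [Prod.fst_sum, Prod.snd_sum, Finset.sum_apply]
  · simp [Prod.snd_sum]

variable [FiniteDimensional K V] [FiniteDimensional K E]

theorem exists_polynomial_independenceMap_injective (hk : 2 ≤ k) (hn : k + 1 ≤ n)
    (hE : Module.finrank K E = k) {b : Fin n → E →ₗ[K] V}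
    (h : IsERCode k k k (k - 1) (k ^ 2 - 1) fun i => LinearMap.range (b i)) (v : Fin n ↪ K)
    (s : Finset (Option (Fin n))) (hs : s.card = k + 1) :
    ∃ P : K[X], P ≠ 0 ∧ P.natDegree ≤ (k + 1) * ((k + 1) * k) * n ∧ ∀ t, P.eval t ≠ 0 →
      Function.Injective (independenceMap fun j : s =>
        extendMaps b (∑ i, (Lagrange.basis Finset.univ v i).eval t • b i) j) := by
  classical
  have hcard : Fintype.card s = k + 1 := by rw [Fintype.card_coe, hs]
  obtain ⟨x, hx⟩ : ∃ x : Fin n, none ∈ s → some x ∉ s := by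
    by_contra! hc
    have hu : s = Finset.univ := by
      refine Finset.eq_univ_of_forall fun o => ?_
      cases o with
      | none => exact (hc ⟨0, by omega⟩).1
      | some x => exact (hc x).2
    rw [hu, Finset.card_univ, Fintype.card_option, Fintype.card_fin] at hs
    omega
  have hg : Function.Injective fun o : s => (o : Option (Fin n)).elim x id := by
    rintro ⟨_ | i, hi⟩ ⟨_ | j, hj⟩ hij
    · rfl
    · exact (hx hi (by simpa [show x = j from hij] using hj)).elim
    · exact (hx hj (by simpa [show i = x from hij] using hi)).elim
    · simpa using hij
  have h₀ : Function.Injective (independenceMap fun j : s =>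
      extendMaps b (∑ i, (Lagrange.basis Finset.univ v i).eval (v x) • b i) j) := by
    have hb : ∑ i, (Lagrange.basis Finset.univ v i).eval (v x) • b i = b x := by
      rw [Finset.sum_eq_single x]
      · rw [Lagrange.eval_basis_self v.injective.injOn (Finset.mem_univ x), one_smul]
      · intro i _ hi
        rw [Lagrange.eval_basis_of_ne hi (Finset.mem_univ x), zero_smul]
      · simp
    have he : (fun j : s => extendMaps b (b x) j) =
        fun o : s => b ((o : Option (Fin n)).elim x id) := by
      ext1 ⟨o, ho⟩
      cases o <;> rfl
    rw [hb, he]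
    exact IsERCode.independenceMap_injective hk hcard hE (h.comp hg)
  have hL (i : Fin n) : (Lagrange.basis Finset.univ v i).natDegree ≤ n := by
    rw [natDegree_eq_of_degree_eq_some
      (Lagrange.degree_basis v.injective.injOn (Finset.mem_univ i))]
    simp
  obtain ⟨P, hP, hdeg, hinj⟩ := LinearMap.exists_polynomial_injective_of_eval_ne_zero _ _ _
    (Lagrange.basis Finset.univ v) n hL (fun t => independenceMap_extendMaps_sum b s _) h₀
  refine ⟨P, hP, hdeg.trans_eq ?_, hinj⟩
  simp [Module.finrank_pi_fintype, hE, hs]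

omit [FiniteDimensional K V] [FiniteDimensional K E] in
theorem relationMap_extendMaps_surjective {α β F : ℕ} {b : Fin n → E →ₗ[K] V}
    (h : IsERCode k k α β F fun i => LinearMap.range (b i)) (c : E →ₗ[K] V)
    {s : Finset (Option (Fin n))} (hs : s.card = k + 1) :
    Function.Surjective (relationMap fun j : s => extendMaps b c j) := by
  classical
  obtain ⟨A, hAs, hA⟩ : ∃ A ⊆ Finset.eraseNone s, A.card = k := by
    apply Finset.exists_subset_card_eq
    by_cases h0 : none ∈ s
    · rw [Finset.card_eraseNone_of_mem h0, hs, Nat.add_sub_cancel]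
    · rw [Finset.card_eraseNone_of_not_mem h0, hs]
      omega
  rw [← LinearMap.range_eq_top, eq_top_iff, ← h.2.2.2.1 A hA]
  intro x hx
  obtain ⟨u, hu, rfl⟩ := Submodule.exists_sum_of_mem_sum hx
  refine Submodule.sum_mem _ fun j hj => ?_
  exact range_le_range_relationMap (fun j : s => extendMaps b c j)
    ⟨some j, Finset.mem_eraseNone.1 (hAs hj)⟩ (hu j hj)

theorem exists_isERCode_extendCode_range [Fintype K] (hk : 2 ≤ k) (hn : k + 1 ≤ n)
    (hE : Module.finrank K E = k)
    (hK : 2 ^ (n + 1) * ((k + 1) * ((k + 1) * k) * n) + n < Fintype.card K)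
    {b : Fin n → E →ₗ[K] V}
    (h : IsERCode k k k (k - 1) (k ^ 2 - 1) fun i => LinearMap.range (b i)) :
    ∃ β : E →ₗ[K] V, IsERCode k k k (k - 1) (k ^ 2 - 1)
      (extendCode (fun i => LinearMap.range (b i)) (LinearMap.range β)) := by
  classical
  obtain ⟨v⟩ : Nonempty (Fin n ↪ K) :=
    Function.Embedding.nonempty_of_card_le (by rw [Fintype.card_fin]; omega)
  choose! P hP hdeg hinj using exists_polynomial_independenceMap_injective hk hn hE h v
  let A := (Finset.univ : Finset (Option (Fin n))).powersetCard (k + 1)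
  have hA (s) : s ∈ A ↔ s.card = k + 1 := by simp [A]
  obtain ⟨t, ht⟩ := (∏ s ∈ A, P s).exists_eval_ne_zero_of_natDegree_lt_card
    (Finset.prod_ne_zero_iff.2 fun s hs => hP s ((hA s).1 hs)) (by
      rw [Cardinal.mk_fintype, Nat.cast_lt]
      refine lt_of_le_of_lt ?_ hK
      refine (natDegree_prod_le _ _).trans ((Finset.sum_le_card_nsmul _ _ _
        fun s hs => hdeg s ((hA s).1 hs)).trans ?_)
      rw [smul_eq_mul]
      refine (Nat.mul_le_mul_right _ ?_).trans (Nat.le_add_right _ _)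
      refine (Finset.card_le_univ A).trans_eq ?_
      rw [Fintype.card_finset, Fintype.card_option, Fintype.card_fin])
  rw [eval_prod, Finset.prod_ne_zero_iff] at ht
  refine ⟨∑ i, (Lagrange.basis Finset.univ v i).eval t • b i, isERCode_of_forall_restrict (by rw [Fintype.card_option, Fintype.card_fin]; omega)
    fun s hs => ?_⟩
  rw [extendCode_range]
  exact isERCode_range_of_independenceMap_injective (by omega) (by rw [Fintype.card_coe, hs]) hE
    h.2.1 (relationMap_extendMaps_surjective h _ hs) (hinj s hs t (ht s ((hA s).2 hs)))

end Extension

/-- for all `k ≥ 2`, `n ≥ k + 1`, there exists `q₀` such that for every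
prime power `q ≥ q₀` (i.e. every finite field `K` with `q₀ ≤ |K|`), every `(n, k, k)`
linear ER regeneration code with parameters `(k, k - 1, k ^ 2 - 1)` over `K` can be
extended by a subspace `Wst` of dimension at most `k` to an `(n + 1, k, k)` linear ER
regeneration code with the same parameters. -/
theorem stmt1 (k n : ℕ) (hk : 2 ≤ k) (hn : k + 1 ≤ n) :
    ∃ q₀ : ℕ, ∀ (K : Type) (_ : Field K) (_ : Fintype K), q₀ ≤ Fintype.card K →
      ∀ (V : Type) (_ : AddCommGroup V) (_ : Module K V)
        (W : Fin n → Submodule K V),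
        IsERCode k k k (k - 1) (k ^ 2 - 1) W →
        ∃ Wst : Submodule K V, Module.finrank K Wst ≤ k ∧
          IsERCode k k k (k - 1) (k ^ 2 - 1) (extendCode W Wst) := by
  refine ⟨2 ^ (n + 1) * ((k + 1) * ((k + 1) * k) * n) + n + 1, ?_⟩
  intro K _ _ hq V _ _ W h
  have := h.1
  have hdim (i : Fin n) : Module.finrank K (W i) = k := by
    obtain ⟨s, his, -, hs⟩ := Finset.exists_subsuperset_card_eq (s := {i})
      (t := (Finset.univ : Finset (Fin n))) (n := k + 1) (by simp) (by simp) (by simpa using hn)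
    exact IsERCode.finrank_eq (N := s) hk (by rw [Fintype.card_coe, hs])
      (h.comp Subtype.val_injective) ⟨i, his (by simp)⟩
  have hE : Module.finrank K (Fin k → K) = k := by simp
  let b (i : Fin n) : (Fin k → K) →ₗ[K] V :=
    (W i).subtype ∘ₗ (LinearEquiv.ofFinrankEq _ _ (hE.trans (hdim i).symm)).toLinearMap
  have hb : (fun i => LinearMap.range (b i)) = W := by
    ext1 i
    rw [LinearMap.range_comp, LinearEquiv.range, Submodule.map_top, Submodule.range_subtype]
  rw [← hb] at h ⊢
  obtain ⟨β, hβ⟩ := exists_isERCode_extendCode_range hk hn hE (by omega) h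
  exact ⟨_, (LinearMap.finrank_range_le β).trans hE.le, hβ⟩
end

section
/- For all integers k ≥ 2, n ≥ k+1 and every real ε > 0 there exists q₀ such that for every prime power q ≥ q₀ the following holds: for every (n,k,k) linear exact-repair regeneration code W_1,…,W_n with parameters (α,β,F) = (k, k−1, k²−1) over 𝔽_q on an ambient space 𝓕, the number of k-dimensional subspaces W_⋆ of 𝓕 for which W_1,…,W_n,W_⋆ form an (n+1,k,k) linear exact-repair regeneration code with the same parameters (k, k−1, k²−1) is greater than (1−ε) times the total number of k-dimensional subspaces of 𝓕. (Equivalently, a uniformly random k-dimensional subspace W_⋆ of 𝓕 extends the code with probability greater than 1−ε.) -/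
namespace Matrix

variable {ι K : Type*} [Fintype ι] [DecidableEq ι] [Field K]

/-- Adding multiples of `u` to the columns of `A` does not change `cramer A u`. -/
theorem cramer_add_vecMulVec_self (A : Matrix ι ι K) (u c : ι → K) :
    cramer (A + vecMulVec u c) u = cramer A u := by
  ext i
  rw [cramer_apply, cramer_apply, ← det_transpose, ← det_transpose (A.updateCol i u)]
  refine det_eq_of_forall_row_eq_smul_add_const (Function.update c i 0) i (by simp) fun a b => ?_
  by_cases h : a = i
  · subst h; simp
  · simp [h, vecMulVec_apply, mul_comm]

/-- The matrix determinant lemma for a rank-one update, without invertibility assumption. -/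
theorem det_add_vecMulVec (A : Matrix ι ι K) (u c : ι → K) :
    (A + vecMulVec u c).det = A.det + ∑ i, c i * cramer A u i := by
  suffices h : ∀ s : Finset ι, (A + vecMulVec u (fun i => if i ∈ s then c i else 0)).det =
      A.det + ∑ i ∈ s, c i * cramer A u i by simpa using h Finset.univ
  intro s
  induction s using Finset.induction_on with
  | empty =>
    have : vecMulVec u (fun _ : ι => (0 : K)) = 0 := by ext; simp [vecMulVec_apply]
    simp [this]
  | insert a s ha ih =>
    set X := A + vecMulVec u (fun i => if i ∈ s then c i else 0) with hX
    have h1 : A + vecMulVec u (fun i => if i ∈ insert a s then c i else 0) =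
        X.updateCol a ((fun i => X i a) + c a • u) := by
      ext i j
      by_cases hj : j = a
      · subst hj; simp [hX, vecMulVec_apply, ha, mul_comm]
      · simp [hX, vecMulVec_apply, hj]
    have h2 : X.updateCol a (fun i => X i a) = X := updateCol_eq_self X a
    rw [h1, det_updateCol_add, det_updateCol_smul, h2, ih, ← cramer_apply, hX,
      cramer_add_vecMulVec_self, Finset.sum_insert ha]
    ring

/-- Finitely many matrices can be made simultaneously singular by rank-one updates that share
their row vector, provided that the associated Cramer system is regular. -/
theorem exists_forall_det_add_vecMulVec_eq_zero {J : Type*} [Fintype J] [DecidableEq J]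
    (e : J → ι) (he : Function.Injective e) (A : J → Matrix ι ι K) (u : J → ι → K)
    (h : (of fun j i => cramer (A j) (u j) (e i)).det ≠ 0) :
    ∃ c : ι → K, (∀ i, i ∉ Set.range e → c i = 0) ∧
      ∀ j, (A j + vecMulVec (u j) c).det = 0 := by
  obtain ⟨t, ht⟩ := mulVec_surjective_iff_isUnit.2
    ((isUnit_iff_isUnit_det _).2 (isUnit_iff_ne_zero.2 h)) (fun j => -(A j).det)
  refine ⟨Function.extend e t 0, fun i hi => Function.extend_apply' _ _ _ hi, fun j => ?_⟩
  have hj := congrFun ht j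
  simp only [mulVec, dotProduct, of_apply] at hj
  rw [det_add_vecMulVec, ← neg_eq_iff_add_eq_zero, ← hj]
  refine (Finset.sum_of_injOn e he.injOn (by simp) (fun i _ hi => ?_) fun i _ => ?_)
  · rw [Function.extend_apply' _ _ _ (by simpa using hi)]; simp
  · rw [he.extend_apply, mul_comm]

/-- Every nonzero vector is a prescribed column of some invertible matrix. -/
theorem exists_det_ne_zero_col_eq (i : ι) (v : ι → K) (hv : v ≠ 0) :
    ∃ A : Matrix ι ι K, A.det ≠ 0 ∧ ∀ a, A a i = v a := by
  obtain ⟨i₀, hi₀⟩ := Function.ne_iff.1 hv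
  refine ⟨((1 : Matrix ι ι K).updateCol i₀ v).submatrix id (Equiv.swap i i₀), ?_, by simp⟩
  rw [det_permute', ← cramer_apply, cramer_one]
  exact mul_ne_zero (by simp [Equiv.Perm.sign_swap']; split_ifs <;> simp) (by simpa using hi₀)

/-- A singular square matrix has range of positive codimension. -/
theorem finrank_range_mulVecLin_le_of_det_eq_zero {m : ℕ}
    (A : Matrix (Fin (m + 1)) (Fin (m + 1)) K) (h : A.det = 0) :
    Module.finrank K (LinearMap.range A.mulVecLin) ≤ m := by
  have h1 : LinearMap.range A.mulVecLin < ⊤ := by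
    rw [lt_top_iff_ne_top, Ne, LinearMap.range_eq_top]
    intro hs
    have := (isUnit_iff_isUnit_det _).1 (mulVec_surjective_iff_isUnit.1 hs)
    simp [h] at this
  simpa [Nat.lt_succ_iff] using Submodule.finrank_lt h1.ne

end Matrix

section PolynomialFunction

variable {K : Type*} [Field K] {E : Type*} [AddCommGroup E] [Module K E] [FiniteDimensional K E]

/-- Functions on a finite-dimensional space that are given, in coordinates, by a polynomial of
total degree at most `d`. -/
def IsPolyFun (K : Type*) [Field K] {E : Type*} [AddCommGroup E] [Module K E]
    [FiniteDimensional K E] (d : ℕ) (f : E → K) : Prop :=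
  ∃ p : MvPolynomial (Fin (Module.finrank K E)) K, p.totalDegree ≤ d ∧
    ∀ x, f x = MvPolynomial.eval ((Module.finBasis K E).equivFun x) p

namespace IsPolyFun

theorem mono {d d' : ℕ} {f : E → K} (hf : IsPolyFun K d f) (h : d ≤ d') : IsPolyFun K d' f :=
  let ⟨p, hp, hfp⟩ := hf
  ⟨p, hp.trans h, hfp⟩

theorem const (d : ℕ) (c : K) : IsPolyFun K d (fun _ : E => c) :=
  ⟨MvPolynomial.C c, by simp, by simp⟩

theorem finset_sum {ι : Type*} (s : Finset ι) {d : ℕ} {f : ι → E → K}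
    (hf : ∀ i ∈ s, IsPolyFun K d (f i)) : IsPolyFun K d (fun x => ∑ i ∈ s, f i x) := by
  choose! p hp hfp using hf
  refine ⟨∑ i ∈ s, p i, MvPolynomial.totalDegree_finsetSum_le hp, fun x => ?_⟩
  rw [map_sum]
  exact Finset.sum_congr rfl fun i hi => hfp i hi x

theorem finset_prod {ι : Type*} (s : Finset ι) {d : ℕ} {f : ι → E → K}
    (hf : ∀ i ∈ s, IsPolyFun K d (f i)) :
    IsPolyFun K (s.card * d) (fun x => ∏ i ∈ s, f i x) := by
  choose! p hp hfp using hf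
  refine ⟨∏ i ∈ s, p i, (MvPolynomial.totalDegree_finsetProd s p).trans ?_, fun x => ?_⟩
  · simpa using Finset.sum_le_card_nsmul s _ d hp
  · rw [map_prod]
    exact Finset.prod_congr rfl fun i hi => hfp i hi x

theorem mul {d d' : ℕ} {f g : E → K} (hf : IsPolyFun K d f) (hg : IsPolyFun K d' g) :
    IsPolyFun K (d + d') (fun x => f x * g x) := by
  obtain ⟨p, hp, hfp⟩ := hf
  obtain ⟨r, hr, hgr⟩ := hg
  exact ⟨p * r, (MvPolynomial.totalDegree_mul p r).trans (add_le_add hp hr),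
    fun x => by simp only [map_mul, hfp, hgr]⟩

theorem neg {d : ℕ} {f : E → K} (hf : IsPolyFun K d f) : IsPolyFun K d (fun x => -f x) := by
  obtain ⟨p, hp, hfp⟩ := hf
  exact ⟨-p, by rwa [MvPolynomial.totalDegree_neg], fun x => by simp only [map_neg, hfp]⟩

theorem linearMap (L : E →ₗ[K] K) : IsPolyFun K 1 (fun x => L x) := by
  refine ⟨∑ i, MvPolynomial.C (L (Module.finBasis K E i)) * MvPolynomial.X i,
    MvPolynomial.totalDegree_finsetSum_le fun i _ =>
      (MvPolynomial.totalDegree_mul _ _).trans (by simp), fun x => ?_⟩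
  simp only [map_sum, map_mul, MvPolynomial.eval_C, MvPolynomial.eval_X]
  conv_lhs => rw [← (Module.finBasis K E).sum_equivFun x, map_sum]
  simp [mul_comm]

/-- A linear functional of one entry of a tuple is a polynomial function of degree one. -/
theorem apply_entry {ι : Type*} [Fintype ι] (L : E →ₗ[K] K) (i : ι) :
    IsPolyFun K 1 (fun y : ι → E => L (y i)) :=
  linearMap (L ∘ₗ (LinearMap.proj i : (ι → E) →ₗ[K] E))

theorem det {ι : Type*} [Fintype ι] [DecidableEq ι] {d : ℕ} {A : E → Matrix ι ι K}
    (hA : ∀ i j, IsPolyFun K d (fun x => A x i j)) :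
    IsPolyFun K (Fintype.card ι * d) (fun x => (A x).det) := by
  simp only [Matrix.det_apply']
  refine finset_sum _ fun σ _ => ?_
  have h := (const (E := E) 0 (((Equiv.Perm.sign σ : ℤ) : K))).mul
    (finset_prod Finset.univ fun i _ => hA (σ i) i)
  simpa using h

theorem cramer {ι : Type*} [Fintype ι] [DecidableEq ι] {d : ℕ} {A : E → Matrix ι ι K}
    {u : E → ι → K} (hA : ∀ i j, IsPolyFun K d (fun x => A x i j))
    (hu : ∀ i, IsPolyFun K d (fun x => u x i)) (i : ι) :
    IsPolyFun K (Fintype.card ι * d) (fun x => Matrix.cramer (A x) (u x) i) := by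
  simp only [Matrix.cramer_apply]
  refine det fun a b => ?_
  by_cases hb : b = i
  · subst hb; simpa using hu a
  · simpa [hb] using hA a b

theorem adjugate {ι : Type*} [Fintype ι] [DecidableEq ι] {d : ℕ} {A : E → Matrix ι ι K}
    (hA : ∀ i j, IsPolyFun K d (fun x => A x i j)) (i j : ι) :
    IsPolyFun K (Fintype.card ι * d) (fun x => (A x).adjugate i j) := by
  simp only [Matrix.adjugate_apply]
  refine det fun a b => ?_
  by_cases ha : a = j
  · subst ha; simpa using const d _
  · simpa [ha] using hA a b

/-- The Schwartz–Zippel lemma for polynomial functions. -/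
theorem ncard_zeros_mul_le [Fintype K] {d : ℕ} {f : E → K} (hf : IsPolyFun K d f) {x₀ : E}
    (hx₀ : f x₀ ≠ 0) : {x | f x = 0}.ncard * Fintype.card K ≤ d * Nat.card E := by
  classical
  obtain ⟨p, hp, hfp⟩ := hf
  have hp0 : p ≠ 0 := by
    rintro rfl
    simp [hfp] at hx₀
  have hq : (0 : ℚ≥0) < Fintype.card K := by exact_mod_cast Fintype.card_pos
  have hE : Nat.card E = Fintype.card K ^ Module.finrank K E := by
    rw [Nat.card_congr (Module.finBasis K E).equivFun.toEquiv]; simp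
  have h1 : {x | f x = 0}.ncard =
      (Finset.univ.filter fun y : Fin (Module.finrank K E) → K =>
        MvPolynomial.eval y p = 0).card := by
    rw [← Set.ncard_coe_finset,
      ← Set.ncard_image_of_injective _ (Module.finBasis K E).equivFun.injective]
    congr 1
    ext y
    simp only [Set.mem_image, Set.mem_ofPred_eq, hfp, Finset.coe_filter, Finset.mem_univ,
      true_and]
    refine ⟨fun ⟨x, hx, hxy⟩ => hxy ▸ hx, fun hy => ?_⟩
    refine ⟨(Module.finBasis K E).equivFun.symm y, ?_, LinearEquiv.apply_symm_apply _ _⟩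
    rwa [LinearEquiv.apply_symm_apply]
  have h2 := MvPolynomial.schwartz_zippel_totalDegree hp0 (Finset.univ : Finset K)
  rw [Fintype.piFinset_univ, ← h1, Finset.card_univ, div_le_div_iff₀ (pow_pos hq _) hq] at h2
  rw [hE]
  have h3 : {x | f x = 0}.ncard * Fintype.card K ≤
      p.totalDegree * Fintype.card K ^ Module.finrank K E := by
    exact_mod_cast h2
  exact h3.trans (Nat.mul_le_mul_right _ hp)

end IsPolyFun

/-- The property `P` fails for a proportion of at most `D / |K|` of the elements of `E`. -/
def HoldsGenerically (K : Type*) [Fintype K] {E : Type*} (D : ℕ) (P : E → Prop) : Prop :=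
  {x | ¬ P x}.ncard * Fintype.card K ≤ D * Nat.card E

namespace HoldsGenerically

theorem of_isPolyFun [Fintype K] {D : ℕ} {P : E → Prop} {f : E → K} (hf : IsPolyFun K D f)
    {x₀ : E} (hx₀ : f x₀ ≠ 0) (h : ∀ x, f x ≠ 0 → P x) : HoldsGenerically K D P := by
  have : Finite E := Module.finite_of_finite K
  refine le_trans (Nat.mul_le_mul_right _ (Set.ncard_le_ncard (fun x hx => ?_) (Set.toFinite _)))
    (hf.ncard_zeros_mul_le hx₀)
  by_contra h0
  exact hx (h x h0)

theorem mono {K : Type*} [Fintype K] {E : Type*} [Finite E] {D : ℕ} {P Q : E → Prop}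
    (hP : HoldsGenerically K D P) (h : ∀ x, P x → Q x) : HoldsGenerically K D Q :=
  le_trans (Nat.mul_le_mul_right _
    (Set.ncard_le_ncard (fun x hx hPx => hx (h x hPx)) (Set.toFinite _))) hP

theorem and {K : Type*} [Fintype K] {E : Type*} {D D' : ℕ} {P Q : E → Prop}
    (hP : HoldsGenerically K D P)
    (hQ : HoldsGenerically K D' Q) : HoldsGenerically K (D + D') (fun x => P x ∧ Q x) := by
  have h : {x | ¬ (P x ∧ Q x)} = {x | ¬ P x} ∪ {x | ¬ Q x} := by
    ext x; simp [imp_iff_not_or]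
  unfold HoldsGenerically at *
  have := Set.ncard_union_le {x | ¬ P x} {x | ¬ Q x}
  rw [h]
  nlinarith

theorem forall_mem {K : Type*} [Fintype K] {E : Type*} {ι : Type*} (s : Finset ι) {D : ℕ}
    {P : ι → E → Prop}
    (h : ∀ i ∈ s, HoldsGenerically K D (P i)) :
    HoldsGenerically K (s.card * D) (fun x => ∀ i ∈ s, P i x) := by
  classical
  induction s using Finset.induction_on with
  | empty => simp [HoldsGenerically]
  | insert a s ha ih =>
    have := (h a (by simp)).and (ih fun i hi => h i (by simp [hi]))
    simpa [Finset.card_insert_of_notMem ha, add_mul, add_comm] using this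

end HoldsGenerically

end PolynomialFunction

section GenericRepair

variable {K : Type*} [Field K] [Fintype K] {V : Type*} [AddCommGroup V] [Module K V]
  [FiniteDimensional K V] {m : ℕ}

theorem sum_apply_col_mem_iSup {K : Type*} [Field K] {V : Type*} [AddCommGroup V] [Module K V]
    {J ι : Type*} [Fintype J] [Fintype ι] [DecidableEq ι]
    (g : J → (ι → K) →ₗ[K] V) (X : J → Matrix ι ι K) (i : ι) :
    ∑ j, g j ((X j).col i) ∈
      ⨆ j, (LinearMap.range (X j).mulVecLin).map (g j) := by
  refine Submodule.sum_mem _ fun j _ => Submodule.mem_iSup_of_mem j ?_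
  exact Submodule.mem_map_of_mem ⟨Pi.single i 1, by simp⟩

/-- A generic tuple of vectors can be repaired from nodes parametrized by `g`, if these nodes
satisfy a single linear relation, and this relation involves every node. -/
theorem holdsGenerically_repair_new (g : Fin (m + 1) → (Fin (m + 1) → K) →ₗ[K] V)
    (s : V →ₗ[K] (Fin (m + 1) → Fin (m + 1) → K)) (hs : ∀ x, ∑ j, g j (s x j) = x)
    (v : Fin (m + 1) → Fin (m + 1) → K) (hv : ∀ j, v j ≠ 0) (hgv : ∑ j, g j (v j) = 0)
    (hker : ∀ h : Fin (m + 1) → Fin (m + 1) → K, ∑ j, g j (h j) = 0 → ∃ c : K, h = c • v) :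
    HoldsGenerically K ((m + 1) * ((m + 1) * 1)) (fun y : Fin (m + 1) → V =>
      ∃ S : Fin (m + 1) → Submodule K V,
        (∀ j, S j ≤ LinearMap.range (g j) ∧ Module.finrank K (S j) ≤ m) ∧
        ∀ i, y i ∈ ⨆ j, S j) := by
  set M : (Fin (m + 1) → V) → Fin (m + 1) → Matrix (Fin (m + 1)) (Fin (m + 1)) K :=
    fun y j => Matrix.of fun a i => s (y i) j a with hM
  have hpoly : IsPolyFun K ((m + 1) * ((m + 1) * 1)) (fun y : Fin (m + 1) → V =>
      (Matrix.of fun j i => Matrix.cramer (M y j) (v j) i).det) := by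
    have h1 : ∀ j i, IsPolyFun K ((m + 1) * 1)
        (fun y : Fin (m + 1) → V => Matrix.cramer (M y j) (v j) i) := fun j i => by
      have := IsPolyFun.cramer (A := fun y => M y j) (u := fun _ => v j) (d := 1)
        (fun a i => IsPolyFun.apply_entry
          (LinearMap.proj a ∘ₗ LinearMap.proj j ∘ₗ s) i) (fun i => IsPolyFun.const 1 _) i
      simpa using this
    have := IsPolyFun.det (A := fun y : Fin (m + 1) → V =>
      Matrix.of fun j i => Matrix.cramer (M y j) (v j) i) h1
    simpa using this
  choose A hA hAcol using fun j => Matrix.exists_det_ne_zero_col_eq j (v j) (hv j)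
  refine HoldsGenerically.of_isPolyFun hpoly
    (x₀ := fun i => ∑ j, g j ((A j).col i)) ?_ fun y hy => ?_
  · have h1 : ∀ i, ∃ c : K, s (∑ j, g j ((A j).col i)) - (fun j => (A j).col i) = c • v := by
      intro i
      apply hker
      simp only [Pi.sub_apply, map_sub, Finset.sum_sub_distrib]
      rw [hs, sub_self]
    choose c hc using h1
    have h2 : ∀ j, M (fun i => ∑ j, g j ((A j).col i)) j = A j + Matrix.vecMulVec (v j) c := by
      intro j
      ext a i
      have := congrFun (congrFun (hc i) j) a
      simp only [Pi.sub_apply, Pi.smul_apply, smul_eq_mul, Matrix.col_apply] at this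
      simp only [hM, Matrix.of_apply, Matrix.add_apply, Matrix.vecMulVec_apply]
      linear_combination this
    have h3 : (Matrix.of fun j i =>
        Matrix.cramer (M (fun i => ∑ j, g j ((A j).col i)) j) (v j) i) =
        Matrix.diagonal fun j => (A j).det := by
      ext j i
      rw [Matrix.of_apply, h2, Matrix.cramer_add_vecMulVec_self,
        Matrix.cramer_row_self _ _ j fun a => (hAcol j a).symm, Matrix.diagonal_apply,
        Pi.single_apply]
      simp [eq_comm]
    rw [h3, Matrix.det_diagonal]
    exact Finset.prod_ne_zero_iff.2 fun j _ => hA j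
  · obtain ⟨c, -, hc⟩ := Matrix.exists_forall_det_add_vecMulVec_eq_zero id
      Function.injective_id (M y) v hy
    refine ⟨fun j => (LinearMap.range (M y j + Matrix.vecMulVec (v j) c).mulVecLin).map (g j),
      fun j => ⟨LinearMap.map_le_range, (Submodule.finrank_map_le _ _).trans
        (Matrix.finrank_range_mulVecLin_le_of_det_eq_zero _ (hc j))⟩, fun i => ?_⟩
    have h1 : y i = ∑ j, g j ((M y j + Matrix.vecMulVec (v j) c).col i) := by
      have h2 : ∀ j, (M y j + Matrix.vecMulVec (v j) c).col i = s (y i) j + c i • v j := by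
        intro j
        ext a
        simp [hM, Matrix.vecMulVec_apply, mul_comm]
      simp only [h2, map_add, map_smul, Finset.sum_add_distrib, ← Finset.smul_sum, hgv, hs,
        smul_zero, add_zero]
    rw [h1]
    exact sum_apply_col_mem_iSup g _ i

/-- Let `V` be decomposed by `q` and `P` into `m` lines spanned by the `w i` and `m` nodes
parametrized by `g`. The span of a generic tuple, together with these nodes, spans `V` and repairs
the node spanned by the `w i` and by a vector of the sum of the nodes with nonzero components. -/
theorem holdsGenerically_repair_old (hm : 1 ≤ m) (w : Fin m → V)
    (g : Fin m → (Fin (m + 1) → K) →ₗ[K] V) (q : V →ₗ[K] (Fin m → K))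
    (P : Fin m → V →ₗ[K] (Fin (m + 1) → K))
    (hdec : ∀ x, ∑ i, q x i • w i + ∑ j, g j (P j x) = x)
    (hqw : ∀ i, q (w i) = Pi.single i 1) (hPw : ∀ i j, P j (w i) = 0)
    (hqg : ∀ j h, q (g j h) = 0) (hPg : ∀ i j h, P i (g j h) = if i = j then h else 0)
    (u : Fin m → Fin (m + 1) → K) (hu : ∀ j, u j ≠ 0) :
    HoldsGenerically K ((m + 1) * 1 + m * ((m + 1) * ((m + 1) * 1 + 1)))
      (fun y : Fin (m + 1) → V => LinearIndependent K y ∧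
        Submodule.span K (Set.range y) ⊔ ⨆ j, LinearMap.range (g j) = ⊤ ∧
        ∃ (T : Submodule K V) (S : Fin m → Submodule K V),
          T ≤ Submodule.span K (Set.range y) ∧ Module.finrank K T ≤ m ∧
          (∀ j, S j ≤ LinearMap.range (g j) ∧ Module.finrank K (S j) ≤ m) ∧
          (∀ i, w i ∈ T ⊔ ⨆ j, S j) ∧ ∑ j, g j (u j) ∈ T ⊔ ⨆ j, S j) := by
  choose A hA hAcol using fun j => Matrix.exists_det_ne_zero_col_eq (Fin.last m) (u j) (hu j)
  set y₀ : Fin (m + 1) → V := Fin.lastCases (∑ j, g j ((A j).col j.castSucc))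
    (fun i => w i - ∑ j, g j ((A j).col i.castSucc)) with hy₀
  have hy₀last : y₀ (Fin.last m) = ∑ j, g j ((A j).col j.castSucc) := by simp [hy₀]
  have hy₀cast : ∀ i : Fin m, y₀ i.castSucc = w i - ∑ j, g j ((A j).col i.castSucc) := by
    simp [hy₀]
  have hPlast : ∀ j, P j (y₀ (Fin.last m)) = (A j).col j.castSucc := fun j => by
    simp [hy₀last, hPg]
  have hPcast : ∀ j i, P j (y₀ (Fin.castSucc i)) = -(A j).col i.castSucc := fun j i => by
    simp [hy₀cast, hPg, hPw]
  have hqlast : q (y₀ (Fin.last m)) = 0 := by simp [hy₀last, hqg]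
  have hqcast : ∀ i : Fin m, q (y₀ i.castSucc) = Pi.single i 1 := fun i => by
    simp [hy₀cast, hqg, hqw]
  obtain ⟨ψ, hψlast, hψcast⟩ : ∃ ψ : V →ₗ[K] K, ψ (y₀ (Fin.last m)) = 1 ∧
      ∀ i : Fin m, ψ (y₀ i.castSucc) = 0 := by
    set j₀ : Fin m := ⟨0, hm⟩
    obtain ⟨a, ha⟩ : ∃ a, A j₀ a j₀.castSucc ≠ 0 := by
      by_contra! h
      exact hA j₀ (Matrix.det_eq_zero_of_column_eq_zero _ h)
    set ψ₀ : V →ₗ[K] K := (A j₀ a j₀.castSucc)⁻¹ • (LinearMap.proj a ∘ₗ P j₀) with hψ₀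
    refine ⟨ψ₀ - ∑ i, ψ₀ (y₀ (Fin.castSucc i)) • (LinearMap.proj i ∘ₗ q), ?_, fun i => ?_⟩
    · simp [hqlast, hψ₀, hPlast, ha]
    · simp [hqcast, Pi.single_apply]
  set φ : V →ₗ[K] (Fin (m + 1) → K) :=
    LinearMap.pi (Fin.lastCases ψ fun a => LinearMap.proj a ∘ₗ q) with hφ
  have hφcast : ∀ x (a : Fin m), φ x a.castSucc = q x a := by simp [hφ]
  have hφlast : ∀ x, φ x (Fin.last m) = ψ x := by simp [hφ]
  set Φ : (Fin (m + 1) → V) → Matrix (Fin (m + 1)) (Fin (m + 1)) K :=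
    fun y => Matrix.of fun a l => φ (y l) a with hΦ
  set Y : (Fin (m + 1) → V) → Fin (m + 1) → V :=
    fun y i => ∑ l, (Φ y).adjugate l i • y l with hY
  set M : (Fin (m + 1) → V) → Fin m → Matrix (Fin (m + 1)) (Fin (m + 1)) K :=
    fun y j => Matrix.of fun a => Fin.lastCases ((Φ y).det * u j a)
      (fun i => -P j (Y y i.castSucc) a) with hM
  have hΦpoly : ∀ a l, IsPolyFun K 1 (fun y => Φ y a l) := fun a l =>
    IsPolyFun.apply_entry (LinearMap.proj a ∘ₗ φ) l
  have hδpoly : IsPolyFun K ((m + 1) * 1) (fun y => (Φ y).det) := by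
    simpa using IsPolyFun.det hΦpoly
  have hYpoly : ∀ (L : V →ₗ[K] K) i, IsPolyFun K ((m + 1) * 1 + 1) (fun y => L (Y y i)) := by
    intro L i
    have h1 : ∀ l, IsPolyFun K ((m + 1) * 1 + 1) (fun y => (Φ y).adjugate l i * L (y l)) :=
      fun l => by
        have := (IsPolyFun.adjugate hΦpoly l i).mul (IsPolyFun.apply_entry L l)
        simpa using this
    have := IsPolyFun.finset_sum Finset.univ fun l _ => h1 l
    simpa [hY] using this
  have hMpoly : ∀ j a i, IsPolyFun K ((m + 1) * 1 + 1) (fun y => M y j a i) := by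
    intro j a i
    induction i using Fin.lastCases with
    | last => simpa [hM] using (hδpoly.mul (IsPolyFun.const 1 (u j a)))
    | cast i => simpa [hM] using (hYpoly (LinearMap.proj a ∘ₗ P j) i.castSucc).neg
  have hNpoly : IsPolyFun K (m * ((m + 1) * ((m + 1) * 1 + 1))) (fun y =>
      (Matrix.of fun j i => Matrix.cramer (M y j) (P j (Y y (Fin.last m)))
        (Fin.castSucc i)).det) := by
    have h1 : ∀ j i : Fin m, IsPolyFun K ((m + 1) * ((m + 1) * 1 + 1)) (fun y =>
        Matrix.cramer (M y j) (P j (Y y (Fin.last m))) (Fin.castSucc i)) := fun j i => by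
      have := IsPolyFun.cramer (hMpoly j)
        (fun a => hYpoly (LinearMap.proj a ∘ₗ P j) (Fin.last m)) i.castSucc
      simpa using this
    have := IsPolyFun.det (A := fun y => Matrix.of fun j i =>
      Matrix.cramer (M y j) (P j (Y y (Fin.last m))) (Fin.castSucc i)) h1
    simpa using this
  refine HoldsGenerically.of_isPolyFun (hδpoly.mul hNpoly) (x₀ := y₀) ?_ fun y hy => ?_
  · have hΦ₀ : Φ y₀ = 1 := by
      ext a l
      simp only [hΦ, Matrix.of_apply]
      induction a using Fin.lastCases with
      | last =>
        induction l using Fin.lastCases with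
        | last => simp [hφlast, hψlast]
        | cast l => simp [hφlast, hψcast, (Fin.castSucc_lt_last l).ne']
      | cast a =>
        induction l using Fin.lastCases with
        | last => simp [hφcast, hqlast, (Fin.castSucc_lt_last a).ne]
        | cast l => simp [hφcast, hqcast, Matrix.one_apply, Pi.single_apply]
    have hY₀ : ∀ i, Y y₀ i = y₀ i := fun i => by
      simp [hY, hΦ₀, Matrix.one_apply]
    have hM₀ : ∀ j, M y₀ j = A j := by
      intro j
      ext a i
      induction i using Fin.lastCases with
      | last => simp [hM, hΦ₀, hAcol]
      | cast i => simp [hM, hY₀, hPcast]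
    have hN₀ : (Matrix.of fun j i => Matrix.cramer (M y₀ j) (P j (Y y₀ (Fin.last m)))
        (Fin.castSucc i)) = Matrix.diagonal fun j => (A j).det := by
      ext j i
      rw [Matrix.of_apply, hM₀, hY₀, hPlast,
        Matrix.cramer_row_self (A j) ((A j).col j.castSucc) j.castSucc fun a => rfl,
        Matrix.diagonal_apply, Pi.single_apply]
      simp [eq_comm]
    simp only [hΦ₀, hN₀, Matrix.det_one, one_mul, Matrix.det_diagonal]
    exact Finset.prod_ne_zero_iff.2 fun j _ => hA j
  · have hδ : (Φ y).det ≠ 0 := left_ne_zero_of_mul hy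
    obtain ⟨c, hc, hX⟩ := Matrix.exists_forall_det_add_vecMulVec_eq_zero Fin.castSucc
      (Fin.castSucc_injective m) (M y) _ (right_ne_zero_of_mul hy)
    have hclast : c (Fin.last m) = 0 := hc _ fun ⟨i, hi⟩ => (Fin.castSucc_lt_last i).ne hi
    set X := fun j => M y j + Matrix.vecMulVec (P j (Y y (Fin.last m))) c with hXdef
    have hφY : ∀ i a, φ (Y y i) a = (Φ y).det * (1 : Matrix _ _ K) a i := by
      intro i a
      have := congrFun (congrFun (Matrix.mul_adjugate (Φ y)) a) i
      rw [Matrix.smul_apply, smul_eq_mul] at this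
      rw [← this, Matrix.mul_apply]
      simp [hY, hΦ, mul_comm]
    have hYmem : ∀ i, Y y i ∈ Submodule.span K (Set.range y) := fun i =>
      Submodule.sum_mem _ fun l _ => Submodule.smul_mem _ _ (Submodule.subset_span ⟨l, rfl⟩)
    have hYcast : ∀ i : Fin m, (Φ y).det • w i + ∑ j, g j (P j (Y y i.castSucc)) =
        Y y i.castSucc := by
      intro i
      conv_rhs => rw [← hdec (Y y i.castSucc)]
      congr 1
      simp [← hφcast, hφY, Matrix.one_apply]
    have hYlast : ∑ j, g j (P j (Y y (Fin.last m))) = Y y (Fin.last m) := by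
      conv_rhs => rw [← hdec (Y y (Fin.last m))]
      simp [← hφcast, hφY, (Fin.castSucc_lt_last _).ne]
    refine ⟨?_, ?_, Submodule.span K (Set.range fun i : Fin m =>
        Y y i.castSucc - c i.castSucc • Y y (Fin.last m)),
      fun j => (LinearMap.range (X j).mulVecLin).map (g j), ?_, ?_, fun j =>
        ⟨LinearMap.map_le_range, (Submodule.finrank_map_le _ _).trans
          (Matrix.finrank_range_mulVecLin_le_of_det_eq_zero _ (hX j))⟩, fun i => ?_, ?_⟩
    · exact LinearIndependent.of_comp φ (Matrix.linearIndependent_cols_of_det_ne_zero hδ)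
    · rw [eq_top_iff]
      rintro x -
      rw [← hdec x]
      have hgmem : ∀ h : Fin m → Fin (m + 1) → K, ∑ j, g j (h j) ∈
          Submodule.span K (Set.range y) ⊔ ⨆ j, LinearMap.range (g j) := fun h =>
        Submodule.mem_sup_right (Submodule.sum_mem _ fun j _ =>
          Submodule.mem_iSup_of_mem j ⟨_, rfl⟩)
      refine add_mem (Submodule.sum_mem _ fun i _ => Submodule.smul_mem _ _ ?_)
        (hgmem fun j => P j x)
      rw [← Submodule.smul_mem_iff _ hδ, eq_sub_of_add_eq (hYcast i)]
      exact sub_mem (Submodule.mem_sup_left (hYmem _)) (hgmem _)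
    · rw [Submodule.span_le]
      rintro _ ⟨i, rfl⟩
      exact sub_mem (hYmem _) (Submodule.smul_mem _ _ (hYmem _))
    · simpa [Set.finrank] using finrank_range_le_card (R := K)
        (b := fun i : Fin m => Y y i.castSucc - c i.castSucc • Y y (Fin.last m))
    · rw [← Submodule.smul_mem_iff _ hδ]
      have h1 : (Φ y).det • w i = (Y y i.castSucc - c i.castSucc • Y y (Fin.last m)) +
          ∑ j, g j ((X j).col i.castSucc) := by
        have h2 : ∀ j, (X j).col i.castSucc =
            -P j (Y y i.castSucc) + c i.castSucc • P j (Y y (Fin.last m)) := by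
          intro j
          ext a
          simp [hXdef, hM, Matrix.vecMulVec_apply, mul_comm]
        simp only [h2, map_add, map_neg, map_smul, Finset.sum_add_distrib,
          Finset.sum_neg_distrib, ← Finset.smul_sum, hYlast]
        rw [eq_sub_of_add_eq (hYcast i)]
        abel
      rw [h1]
      exact add_mem (Submodule.mem_sup_left (Submodule.subset_span ⟨i, rfl⟩))
        (Submodule.mem_sup_right (sum_apply_col_mem_iSup g X _))
    · rw [← Submodule.smul_mem_iff _ hδ]
      have h1 : (Φ y).det • ∑ j, g j (u j) = ∑ j, g j ((X j).col (Fin.last m)) := by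
        have h2 : ∀ j, (X j).col (Fin.last m) = (Φ y).det • u j := by
          intro j
          ext a
          simp [hXdef, hM, Matrix.vecMulVec_apply, hclast]
        simp only [h2, map_smul, ← Finset.smul_sum]
      rw [h1]
      exact Submodule.mem_sup_right (sum_apply_col_mem_iSup g X _)

end GenericRepair

section CodeStructure

variable {K : Type} [Field K] {V : Type} [AddCommGroup V] [Module K V] {ι : Type} {m : ℕ}

theorem Submodule.sum_univ_eq_iSup {J : Type*} [Fintype J] (S : J → Submodule K V) :
    ∑ j, S j = ⨆ j, S j :=
  le_antisymm (Finset.sum_induction _ (· ≤ ⨆ j, S j) (fun _ _ => sup_le) bot_le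
    fun j _ => le_iSup S j)
    (iSup_le fun j => Finset.single_le_sum (fun _ _ => bot_le) (Finset.mem_univ j))

theorem Submodule.iSup_fin_succ (S : Fin (m + 1) → Submodule K V) :
    ⨆ i, S i = S 0 ⊔ ⨆ i : Fin m, S i.succ := by
  simp only [← Submodule.sum_univ_eq_iSup, Fin.sum_univ_succ, Submodule.add_eq_sup]

theorem LinearMap.mem_iSup_range_iff {J : Type*} [Fintype J] {E : Type*}
    [AddCommGroup E] [Module K E] (g : J → E →ₗ[K] V) (x : V) :
    x ∈ ⨆ j, LinearMap.range (g j) ↔ ∃ h : J → E, ∑ j, g j (h j) = x := by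
  classical
  constructor
  · intro hx
    have h1 : ⨆ j, LinearMap.range (g j) ≤
        LinearMap.range (∑ j, g j ∘ₗ LinearMap.proj (R := K) (φ := fun _ : J => E) j) := by
      refine iSup_le fun j => ?_
      rintro _ ⟨a, rfl⟩
      refine ⟨Pi.single j a, ?_⟩
      rw [LinearMap.sum_apply, Finset.sum_eq_single j]
      · simp
      · intro i _ hi; simp [hi]
      · simp
    obtain ⟨h, rfl⟩ := h1 hx
    exact ⟨h, by simp⟩
  · rintro ⟨h, rfl⟩
    exact Submodule.sum_mem _ fun j _ => Submodule.mem_iSup_of_mem j ⟨_, rfl⟩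

theorem Submodule.exists_linearMap_range_eq [FiniteDimensional K V] {k : ℕ} {W : Submodule K V}
    (h : Module.finrank K W ≤ k) : ∃ g : (Fin k → K) →ₗ[K] V, LinearMap.range g = W := by
  refine ⟨W.subtype ∘ₗ (Module.finBasis K W).equivFun.symm.toLinearMap ∘ₗ
    LinearMap.funLeft K K (Fin.castLE h), ?_⟩
  rw [LinearMap.range_comp, LinearMap.range_eq_top.2, Submodule.map_top, Submodule.range_subtype]
  exact (Module.finBasis K W).equivFun.symm.surjective.comp
    (LinearMap.funLeft_surjective_of_injective K K _ (Fin.castLE_injective h))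

theorem Finset.exists_embedding_map_univ_eq (A : Finset ι) {c : ℕ} (h : A.card = c) :
    ∃ e : Fin c ↪ ι, Finset.univ.map e = A := by
  refine ⟨(A.equivFinOfCardEq h).symm.toEmbedding.trans (Function.Embedding.subtype _), ?_⟩
  ext x
  simp only [Finset.mem_map, Finset.mem_univ, true_and]
  constructor
  · rintro ⟨i, rfl⟩
    exact ((A.equivFinOfCardEq h).symm i).2
  · exact fun hx => ⟨A.equivFinOfCardEq h ⟨x, hx⟩, by simp⟩

/-- Prepend a new element to an injective tuple. -/
def consEmbedding (x : ι) (e : Fin m ↪ ι) (hx : x ∉ Set.range e) : Fin (m + 1) ↪ ι :=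
  ⟨Fin.cons x e, Fin.cons_injective_iff.2 ⟨hx, e.injective⟩⟩

namespace IsERCode

variable {W : ι → Submodule K V} {k d α β F : ℕ}

theorem iSup_eq_top (hW : IsERCode k d α β F W) (e : Fin k ↪ ι) : ⨆ i, W (e i) = ⊤ := by
  rw [← Submodule.sum_univ_eq_iSup]
  simpa using hW.2.2.2.1 (Finset.univ.map e) (by simp)

theorem exists_repair (hW : IsERCode k d α β F W) (e : Fin d ↪ ι) (x : ι)
    (hx : x ∉ Set.range e) :
    ∃ S : Fin d → Submodule K V, (∀ i, S i ≤ W (e i) ∧ Module.finrank K (S i) ≤ β) ∧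
      W x ≤ ⨆ i, S i := by
  obtain ⟨S, hS, hxS⟩ := hW.2.2.2.2 x (Finset.univ.map e) (by simpa using hx) (by simp)
  refine ⟨fun i => S (e i), fun i => hS _ (by simp), ?_⟩
  rwa [Finset.sum_map, Submodule.sum_univ_eq_iSup] at hxS

theorem sup_iSup_eq_top (hW : IsERCode (m + 1) d α β F W) (e : Fin m ↪ ι) (x : ι)
    (hx : x ∉ Set.range e) : W x ⊔ ⨆ i, W (e i) = ⊤ := by
  rw [← hW.iSup_eq_top (consEmbedding x e hx), Submodule.iSup_fin_succ]
  rfl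

variable [Fintype ι]

/-- Any `m` nodes of the code are linearly independent. -/
theorem eq_zero_of_sum_eq_zero
    (hW : IsERCode (m + 1) (m + 1) (m + 1) m ((m + 1) ^ 2 - 1) W) (hι : m + 2 ≤ Fintype.card ι)
    (g : ι → (Fin (m + 1) → K) →ₗ[K] V) (hg : ∀ i, LinearMap.range (g i) = W i) (e : Fin m ↪ ι)
    (h : Fin m → Fin (m + 1) → K) (hh : ∑ i, g (e i) (h i) = 0) : h = 0 := by
  classical
  have := hW.1
  obtain ⟨z, hz⟩ : ∃ z, z ∉ Finset.univ.map e := by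
    by_contra! hall
    have := Finset.card_le_card (fun i _ => hall i : Finset.univ ⊆ Finset.univ.map e)
    simp at this
    omega
  replace hz : z ∉ Set.range e := by simpa using hz
  obtain ⟨x, hx⟩ : ∃ x, x ∉ Finset.univ.map (consEmbedding z e hz) := by
    by_contra! hall
    have := Finset.card_le_card
      (fun i _ => hall i : Finset.univ ⊆ Finset.univ.map (consEmbedding z e hz))
    simp at this
    omega
  replace hx : x ∉ Set.range (consEmbedding z e hz) := by simpa using hx
  have hxe : x ∉ Set.range e := fun ⟨i, hi⟩ => hx ⟨i.succ, by simpa [consEmbedding] using hi⟩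
  obtain ⟨S, hS, hxS⟩ := hW.exists_repair _ x hx
  rw [Submodule.iSup_fin_succ] at hxS
  set U := ⨆ i, W (e i) with hU
  have htop : S 0 ⊔ U = ⊤ := by
    rw [eq_top_iff, ← hW.sup_iSup_eq_top e x hxe]
    refine sup_le (hxS.trans (sup_le_sup_left (iSup_le fun i => ?_) _)) le_sup_right
    exact ((hS i.succ).1.trans (by simp [consEmbedding])).trans (le_iSup (fun i => W (e i)) i)
  have hUdim : m * (m + 1) ≤ Module.finrank K U := by
    have h1 := Submodule.finrank_add_le_finrank_add_finrank (S 0) U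
    rw [htop, finrank_top, hW.2.1] at h1
    have h2 := (hS 0).2
    have h3 : (m + 1) ^ 2 - 1 = m * (m + 1) + m := by
      rw [Nat.sub_eq_iff_eq_add (Nat.one_le_pow _ _ (by omega))]; ring
    omega
  set G : (Fin m → Fin (m + 1) → K) →ₗ[K] V := ∑ i, g (e i) ∘ₗ LinearMap.proj i with hG
  have hGapp : ∀ h, G h = ∑ i, g (e i) (h i) := fun h => by simp [hG]
  have hrange : LinearMap.range G = U := by
    ext v
    simp only [hU, ← hg, LinearMap.mem_iSup_range_iff, LinearMap.mem_range, hGapp]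
  have hrn := LinearMap.finrank_range_add_finrank_ker G
  rw [hrange] at hrn
  simp [Module.finrank_pi_fintype] at hrn
  have hker : LinearMap.ker G = ⊥ := by
    rw [← Submodule.finrank_eq_zero (R := K)]
    omega
  exact LinearMap.ker_eq_bot'.1 hker h (by rw [hGapp, hh])

/-- Any `m + 1` nodes satisfy a unique linear relation, which involves each of them. -/
theorem exists_relation
    (hW : IsERCode (m + 1) (m + 1) (m + 1) m ((m + 1) ^ 2 - 1) W) (hι : m + 2 ≤ Fintype.card ι)
    (g : ι → (Fin (m + 1) → K) →ₗ[K] V) (hg : ∀ i, LinearMap.range (g i) = W i)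
    (e : Fin (m + 1) ↪ ι) :
    ∃ v : Fin (m + 1) → Fin (m + 1) → K, (∀ j, v j ≠ 0) ∧ ∑ j, g (e j) (v j) = 0 ∧
      ∀ h : Fin (m + 1) → Fin (m + 1) → K, ∑ j, g (e j) (h j) = 0 → ∃ c : K, h = c • v := by
  have := hW.1
  set G : (Fin (m + 1) → Fin (m + 1) → K) →ₗ[K] V := ∑ i, g (e i) ∘ₗ LinearMap.proj i with hG
  have hGapp : ∀ h, G h = ∑ i, g (e i) (h i) := fun h => by simp [hG]
  have hrange : LinearMap.range G = ⊤ := by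
    rw [← hW.iSup_eq_top e]
    ext v
    simp only [← hg, LinearMap.mem_iSup_range_iff, LinearMap.mem_range, hGapp]
  have hrn := LinearMap.finrank_range_add_finrank_ker G
  rw [hrange, finrank_top, hW.2.1] at hrn
  simp [Module.finrank_pi_fintype] at hrn
  have hker : Module.finrank K (LinearMap.ker G) = 1 := by
    have h1 : 1 ≤ (m + 1) ^ 2 := Nat.one_le_pow _ _ (by omega)
    have h2 : (m + 1) ^ 2 = (m + 1) * (m + 1) := sq _
    omega
  obtain ⟨⟨v, hv⟩, hv0, hvspan⟩ := finrank_eq_one_iff'.1 hker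
  rw [LinearMap.mem_ker, hGapp] at hv
  refine ⟨v, fun j hj => hv0 ?_, hv, fun h hh => ?_⟩
  · have h1 := hW.eq_zero_of_sum_eq_zero hι g hg ((Fin.succAboveEmb j).trans e)
      (fun i => v (j.succAbove i)) (by
        rw [Fin.sum_univ_succAbove _ j, hj, map_zero, zero_add] at hv
        simpa using hv)
    refine Subtype.ext (funext fun i => ?_)
    rcases Fin.eq_self_or_eq_succAbove j i with rfl | ⟨i, rfl⟩
    · exact hj
    · exact congrFun h1 i
  · obtain ⟨c, hc⟩ := hvspan ⟨h, by rw [LinearMap.mem_ker, hGapp, hh]⟩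
    exact ⟨c, (congrArg Subtype.val hc).symm⟩

theorem holdsGenerically_repair_new [Fintype K]
    (hW : IsERCode (m + 1) (m + 1) (m + 1) m ((m + 1) ^ 2 - 1) W) (hι : m + 2 ≤ Fintype.card ι)
    (e : Fin (m + 1) ↪ ι) :
    HoldsGenerically K ((m + 1) * ((m + 1) * 1)) (fun y : Fin (m + 1) → V =>
      ∃ S : Fin (m + 1) → Submodule K V,
        (∀ j, S j ≤ W (e j) ∧ Module.finrank K (S j) ≤ m) ∧
        Submodule.span K (Set.range y) ≤ ⨆ j, S j) := by
  have := hW.1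
  choose g hg using fun i => Submodule.exists_linearMap_range_eq (hW.2.2.1 i)
  obtain ⟨v, hv, hgv, hker⟩ := hW.exists_relation hι g hg e
  set G : (Fin (m + 1) → Fin (m + 1) → K) →ₗ[K] V := ∑ i, g (e i) ∘ₗ LinearMap.proj i with hG
  have hGapp : ∀ h, G h = ∑ i, g (e i) (h i) := fun h => by simp [hG]
  have hrange : LinearMap.range G = ⊤ := by
    rw [← hW.iSup_eq_top e]
    ext v
    simp only [← hg, LinearMap.mem_iSup_range_iff, LinearMap.mem_range, hGapp]
  obtain ⟨s, hs⟩ := G.exists_rightInverse_of_surjective hrange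
  simpa only [hg, Submodule.span_le, Set.range_subset_iff, SetLike.mem_coe] using
    _root_.holdsGenerically_repair_new (fun j => g (e j)) s
      (fun x => by rw [← hGapp, ← LinearMap.comp_apply, hs, LinearMap.id_apply]) v hv hgv hker

theorem holdsGenerically_repair_old [Fintype K] (hm : 1 ≤ m)
    (hW : IsERCode (m + 1) (m + 1) (m + 1) m ((m + 1) ^ 2 - 1) W) (hι : m + 2 ≤ Fintype.card ι)
    (e : Fin m ↪ ι) (x : ι) (hx : x ∉ Set.range e) :
    HoldsGenerically K ((m + 1) * 1 + m * ((m + 1) * ((m + 1) * 1 + 1)))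
      (fun y : Fin (m + 1) → V => LinearIndependent K y ∧
        Submodule.span K (Set.range y) ⊔ ⨆ j, W (e j) = ⊤ ∧
        ∃ (T : Submodule K V) (S : Fin m → Submodule K V),
          T ≤ Submodule.span K (Set.range y) ∧ Module.finrank K T ≤ m ∧
          (∀ j, S j ≤ W (e j) ∧ Module.finrank K (S j) ≤ m) ∧ W x ≤ T ⊔ ⨆ j, S j) := by
  have := hW.1
  choose g hg using fun i => Submodule.exists_linearMap_range_eq (hW.2.2.1 i)
  obtain ⟨v, hv, hgv, -⟩ := hW.exists_relation hι g hg (consEmbedding x e hx)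
  obtain ⟨B, hB, hBcol⟩ := Matrix.exists_det_ne_zero_col_eq (Fin.last m) (v 0) (hv 0)
  set w : Fin m → V := fun i => g x (B.col i.castSucc) with hw
  set u : Fin m → Fin (m + 1) → K := fun i => -v i.succ with hu
  have hlast : g x (B.col (Fin.last m)) = ∑ j, g (e j) (u j) := by
    have h1 : B.col (Fin.last m) = v 0 := funext hBcol
    rw [Fin.sum_univ_succ] at hgv
    simp only [hu, map_neg, Finset.sum_neg_distrib, h1]
    exact eq_neg_of_add_eq_zero_left hgv
  have hgx : ∀ a, ∃ b : Fin (m + 1) → K,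
      g x a = ∑ i : Fin m, b i.castSucc • w i + b (Fin.last m) • ∑ j, g (e j) (u j) := by
    intro a
    obtain ⟨b, rfl⟩ := Matrix.mulVec_surjective_iff_isUnit.2
      ((Matrix.isUnit_iff_isUnit_det _).2 (isUnit_iff_ne_zero.2 hB)) a
    refine ⟨b, ?_⟩
    have h1 : B.mulVec b = ∑ i, b i • B.col i := by
      rw [Matrix.mulVec_eq_sum]; simp [Matrix.col_def]
    rw [h1, map_sum, Fin.sum_univ_castSucc]
    simp [hw, hlast]
  set Ψ : ((Fin m → K) × (Fin m → Fin (m + 1) → K)) →ₗ[K] V :=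
    (Fintype.linearCombination K w).coprod (∑ i, g (e i) ∘ₗ LinearMap.proj i) with hΨ
  have hΨapp : ∀ t h, Ψ (t, h) = ∑ i, t i • w i + ∑ j, g (e j) (h j) := fun t h => by
    simp [hΨ, Fintype.linearCombination_apply]
  have hsurj : Function.Surjective Ψ := by
    intro z
    have hz : z ∈ W x ⊔ ⨆ i, W (e i) := by rw [hW.sup_iSup_eq_top e x hx]; trivial
    simp only [← hg] at hz
    obtain ⟨z₁, ⟨a, rfl⟩, z₂, hz₂, rfl⟩ := Submodule.mem_sup.1 hz
    obtain ⟨h, rfl⟩ := (LinearMap.mem_iSup_range_iff _ _).1 hz₂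
    obtain ⟨b, hb⟩ := hgx a
    refine ⟨(fun i => b i.castSucc, b (Fin.last m) • u + h), ?_⟩
    rw [hΨapp, hb]
    simp [Finset.sum_add_distrib, Finset.smul_sum, add_assoc]
  have hinj : Function.Injective Ψ := by
    refine (LinearMap.injective_iff_surjective_of_finrank_eq_finrank ?_).2 hsurj
    rw [hW.2.1, eq_comm, Nat.sub_eq_iff_eq_add (Nat.one_le_pow _ _ (by omega))]
    simp [Module.finrank_pi_fintype]
    ring
  set Θ := LinearEquiv.ofBijective Ψ ⟨hinj, hsurj⟩ with hΘ
  have hΘsymm : ∀ t h, Θ.symm (∑ i, t i • w i + ∑ j, g (e j) (h j)) = (t, h) := fun t h => by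
    rw [← hΨapp, LinearEquiv.symm_apply_eq]
    rfl
  have hΘw : ∀ i, Θ.symm (w i) = (Pi.single i 1, 0) := fun i => by
    rw [← hΘsymm]
    congr 1
    simp [Pi.single_apply]
  have hΘg : ∀ j h, Θ.symm (g (e j) h) = (0, Pi.single j h) := fun j h => by
    rw [← hΘsymm]
    congr 1
    simp only [Pi.zero_apply, zero_smul, Finset.sum_const_zero, zero_add]
    rw [Finset.sum_eq_single j (fun i _ hi => by simp [hi]) (by simp), Pi.single_eq_same]
  have key := _root_.holdsGenerically_repair_old hm w (fun j => g (e j))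
    (LinearMap.fst K _ _ ∘ₗ Θ.symm.toLinearMap)
    (fun j => LinearMap.proj j ∘ₗ LinearMap.snd K _ _ ∘ₗ Θ.symm.toLinearMap)
    (fun z => by
      have h1 := Θ.apply_symm_apply z
      conv_rhs => rw [← h1]
      exact (hΨapp _ _).symm)
    (fun i => by simp [hΘw]) (fun i j => by simp [hΘw]) (fun j h => by simp [hΘg])
    (fun i j h => by
      by_cases hij : i = j
      · subst hij; simp [hΘg]
      · simp [hΘg, hij])
    u (fun j => neg_ne_zero.2 (hv _))
  simp only [hg] at key
  have : Finite V := Module.finite_of_finite K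
  refine key.mono fun y hy => ?_
  obtain ⟨h1, h2, T, S, hT, hTm, hS, hwS, huS⟩ := hy
  refine ⟨h1, h2, T, S, hT, hTm, hS, ?_⟩
  rw [← hg]
  rintro _ ⟨a, rfl⟩
  obtain ⟨b, hb⟩ := hgx a
  rw [hb]
  exact add_mem (Submodule.sum_mem _ fun i _ => Submodule.smul_mem _ _ (hwS i))
    (Submodule.smul_mem _ _ huS)

end IsERCode

end CodeStructure

section Extension

variable {K : Type} [Field K] {V : Type} [AddCommGroup V] [Module K V] {ι : Type} {m : ℕ}

theorem IsERCode.of_extension {W : ι → Submodule K V} {α β F : ℕ}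
    (hW : IsERCode (m + 1) (m + 1) α β F W) {Wst : Submodule K V}
    (hα : Module.finrank K Wst ≤ α)
    (hnew : ∀ e : Fin (m + 1) ↪ ι, ∃ S : Fin (m + 1) → Submodule K V,
      (∀ j, S j ≤ W (e j) ∧ Module.finrank K (S j) ≤ β) ∧ Wst ≤ ⨆ j, S j)
    (hrec : ∀ e : Fin m ↪ ι, Wst ⊔ ⨆ j, W (e j) = ⊤)
    (hold : ∀ (e : Fin m ↪ ι) (x : ι), x ∉ Set.range e →
      ∃ (T : Submodule K V) (S : Fin m → Submodule K V),
        T ≤ Wst ∧ Module.finrank K T ≤ β ∧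
        (∀ j, S j ≤ W (e j) ∧ Module.finrank K (S j) ≤ β) ∧ W x ≤ T ⊔ ⨆ j, S j) :
    IsERCode (m + 1) (m + 1) α β F (extendCode W Wst) := by
  classical
  have hcases : ∀ A : Finset (Option ι), A.card = m + 1 →
      (∃ e : Fin (m + 1) ↪ ι, A = (Finset.univ.map e).map Function.Embedding.some) ∨
      ∃ e : Fin m ↪ ι, A = (Finset.univ.map e).insertNone := by
    intro A hA
    by_cases hnone : none ∈ A
    · right
      have h1 : (Finset.eraseNone A).insertNone = A := by
        rw [Finset.insertNone_eraseNone, Finset.insert_eq_self.2 hnone]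
      obtain ⟨e, he⟩ := Finset.exists_embedding_map_univ_eq (Finset.eraseNone A) (c := m) (by
        rw [← h1, Finset.card_insertNone] at hA
        omega)
      exact ⟨e, by rw [he, h1]⟩
    · left
      have h1 : (Finset.eraseNone A).map Function.Embedding.some = A := by
        rw [Finset.map_some_eraseNone, Finset.erase_eq_of_notMem hnone]
      obtain ⟨e, he⟩ := Finset.exists_embedding_map_univ_eq (Finset.eraseNone A) (c := m + 1) (by
        rw [← h1, Finset.card_map] at hA
        exact hA)
      exact ⟨e, by rw [he, h1]⟩
  have hsome : ∀ (S : Option ι → Submodule K V) {c : ℕ} (e : Fin c ↪ ι),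
      ∑ j ∈ (Finset.univ.map e).map Function.Embedding.some, S j = ⨆ i, S (some (e i)) := by
    intro S c e
    rw [Finset.sum_map, Finset.sum_map, Submodule.sum_univ_eq_iSup]
    rfl
  have hinsert : ∀ (S : Option ι → Submodule K V) {c : ℕ} (e : Fin c ↪ ι),
      ∑ j ∈ (Finset.univ.map e).insertNone, S j = S none ⊔ ⨆ i, S (some (e i)) := by
    intro S c e
    rw [Finset.sum_insertNone, Finset.sum_map, Submodule.sum_univ_eq_iSup, Submodule.add_eq_sup]
  have hextend : ∀ {c : ℕ} (e : Fin c ↪ ι) (T : Submodule K V) (S : Fin c → Submodule K V),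
      ∃ S' : Option ι → Submodule K V, S' none = T ∧ ∀ i, S' (some (e i)) = S i :=
    fun e T S => ⟨fun o => o.elim T (Function.extend e S ⊥), rfl,
      fun i => e.injective.extend_apply _ _ _⟩
  refine ⟨hW.1, hW.2.1, ?_, fun A hA => ?_, fun x A hxA hA => ?_⟩
  · rintro (_ | i)
    · exact hα
    · exact hW.2.2.1 i
  · obtain ⟨e, rfl⟩ | ⟨e, rfl⟩ := hcases A hA
    · rw [hsome]
      exact hW.iSup_eq_top e
    · rw [hinsert]
      exact hrec e
  · obtain ⟨e, rfl⟩ | ⟨e, rfl⟩ := hcases A hA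
    · obtain ⟨S, hS, hxS⟩ : ∃ S : Fin (m + 1) → Submodule K V,
          (∀ i, S i ≤ W (e i) ∧ Module.finrank K (S i) ≤ β) ∧
          extendCode W Wst x ≤ ⨆ i, S i := by
        rcases x with _ | x
        · exact hnew e
        · exact hW.exists_repair e x (by simpa using hxA)
      obtain ⟨S', -, hS'⟩ := hextend e ⊥ S
      refine ⟨S', ?_, ?_⟩
      · simp only [Finset.mem_map, Finset.mem_univ, true_and, Function.Embedding.some_apply]
        rintro _ ⟨_, ⟨i, rfl⟩, rfl⟩
        rw [hS']
        exact hS i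
      · simpa only [hsome, hS'] using hxS
    · rcases x with _ | x
      · simp at hxA
      · obtain ⟨T, S, hT, hTβ, hS, hxS⟩ := hold e x (by simpa using hxA)
        obtain ⟨S', hnone, hS'⟩ := hextend e T S
        refine ⟨S', ?_, ?_⟩
        · rintro (_ | j) hj
          · rw [hnone]
            exact ⟨hT, hTβ⟩
          · obtain ⟨i, rfl⟩ : ∃ i, e i = j := by simpa using hj
            rw [hS']
            exact hS i
        · rw [hinsert, hnone]
          simp only [hS']
          exact hxS

/-- The constant in `IsERCode.holdsGenerically_extendCode`. -/
noncomputable def extensionDegree (m n : ℕ) : ℕ :=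
  (Finset.univ : Finset (Fin (m + 1) ↪ Fin n)).card * ((m + 1) * ((m + 1) * 1)) +
    {p : (Fin m ↪ Fin n) × Fin n | p.2 ∉ Set.range p.1}.toFinset.card *
      ((m + 1) * 1 + m * ((m + 1) * ((m + 1) * 1 + 1)))

theorem IsERCode.holdsGenerically_extendCode [Fintype K] {n : ℕ} {W : Fin n → Submodule K V}
    (hm : 1 ≤ m) (hn : m + 2 ≤ n)
    (hW : IsERCode (m + 1) (m + 1) (m + 1) m ((m + 1) ^ 2 - 1) W) :
    HoldsGenerically K (extensionDegree m n) (fun y : Fin (m + 1) → V =>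
      LinearIndependent K y ∧ IsERCode (m + 1) (m + 1) (m + 1) m ((m + 1) ^ 2 - 1)
        (extendCode W (Submodule.span K (Set.range y)))) := by
  have := hW.1
  have : Finite V := Module.finite_of_finite K
  have hι : m + 2 ≤ Fintype.card (Fin n) := by simpa using hn
  have hout : ∀ e : Fin m ↪ Fin n, ∃ x, x ∉ Set.range e := by
    intro e
    by_contra! h
    have := Fintype.card_le_of_surjective e h
    simp at this
    omega
  have hnew := HoldsGenerically.forall_mem Finset.univ
    fun (e : Fin (m + 1) ↪ Fin n) _ => hW.holdsGenerically_repair_new hι e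
  have hold := HoldsGenerically.forall_mem
    {p : (Fin m ↪ Fin n) × Fin n | p.2 ∉ Set.range p.1}.toFinset
    fun p hp => hW.holdsGenerically_repair_old hm hι p.1 p.2 (by simpa using hp)
  refine (hnew.and hold).mono fun y hy => ?_
  obtain ⟨h1, h2⟩ := hy
  replace h2 := fun (e : Fin m ↪ Fin n) x (hx : x ∉ Set.range e) => h2 (e, x) (by simpa using hx)
  obtain ⟨x₀, hx₀⟩ := hout (Fin.castLEEmb (by omega))
  refine ⟨(h2 _ x₀ hx₀).1, hW.of_extension ?_ (fun e => h1 e (Finset.mem_univ _)) (fun e => ?_)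
    fun e x hx => (h2 e x hx).2.2⟩
  · rw [finrank_span_eq_card (h2 _ x₀ hx₀).1, Fintype.card_fin]
  · obtain ⟨x, hx⟩ := hout e
    exact (h2 e x hx).2.1

end Extension

section Counting

variable {K : Type*} [Field K] {V : Type*} [AddCommGroup V] [Module K V]
  [FiniteDimensional K V] {k : ℕ}

theorem ncard_linearIndependent_span_eq (W : Submodule K V) (hW : Module.finrank K W = k) :
    {y : Fin k → V | LinearIndependent K y ∧ Submodule.span K (Set.range y) = W}.ncard =
      {z : Fin k → Fin k → K | LinearIndependent K z}.ncard := by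
  set b := (Module.finBasisOfFinrankEq K W hW).equivFun.symm with hb
  set ι : (Fin k → K) →ₗ[K] V := W.subtype ∘ₗ b.toLinearMap with hι
  have hinj : Function.Injective ι := W.injective_subtype.comp b.injective
  rw [← Set.ncard_image_of_injective (f := fun z : Fin k → Fin k → K => fun i => ι (z i)) _
    fun z z' h => funext fun i => hinj (congrFun h i)]
  congr 1
  ext y
  constructor
  · rintro ⟨hy, hspan⟩
    have hmem : ∀ i, y i ∈ W := fun i => hspan ▸ Submodule.subset_span ⟨i, rfl⟩
    have hz : ∀ i, ι (b.symm ⟨y i, hmem i⟩) = y i := fun i => by simp [hι]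
    exact ⟨fun i => b.symm ⟨y i, hmem i⟩,
      LinearIndependent.of_comp ι (by simpa only [Function.comp_def, hz] using hy), funext hz⟩
  · rintro ⟨z, hz, rfl⟩
    have hy := hz.map' ι (LinearMap.ker_eq_bot.2 hinj)
    refine ⟨hy, Submodule.eq_of_le_of_finrank_eq ?_ ?_⟩
    · rw [Submodule.span_le]
      rintro _ ⟨i, rfl⟩
      exact (b (z i)).2
    · rw [hW]
      exact (finrank_span_eq_card hy).trans (Fintype.card_fin k)

theorem ncard_linearIndependent_span_mem [Finite K] (s : Set (Submodule K V))
    (hs : ∀ W ∈ s, Module.finrank K W = k) :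
    {y : Fin k → V | LinearIndependent K y ∧ Submodule.span K (Set.range y) ∈ s}.ncard =
      s.ncard * {z : Fin k → Fin k → K | LinearIndependent K z}.ncard := by
  classical
  have : Finite V := Module.finite_of_finite K
  have : Finite (Submodule K V) := Finite.of_injective _ SetLike.coe_injective
  have := Fintype.ofFinite (Submodule K V)
  have := Fintype.ofFinite V
  rw [Set.ncard_eq_toFinset_card', Set.ncard_eq_toFinset_card' s,
    Finset.card_eq_sum_card_fiberwise (f := fun y => Submodule.span K (Set.range y))
      (t := s.toFinset) (fun y hy => by simpa using (by simpa using hy : _ ∧ _).2),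
    Finset.sum_const_nat]
  intro W hW
  rw [Set.mem_toFinset] at hW
  rw [← ncard_linearIndependent_span_eq W (hs W hW), Set.ncard_eq_toFinset_card']
  congr 1
  ext y
  simp only [Finset.mem_filter, Set.mem_toFinset, Set.mem_ofPred_eq]
  constructor
  · rintro ⟨⟨h1, -⟩, h2⟩
    exact ⟨h1, h2⟩
  · rintro ⟨h1, rfl⟩
    exact ⟨⟨h1, hW⟩, rfl⟩

theorem HoldsGenerically.lt_ncard {K : Type*} [Field K] [Fintype K] {V : Type*} [AddCommGroup V]
    [Module K V] [FiniteDimensional K V] {k D : ℕ} {P : Submodule K V → Prop} {ε : ℝ}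
    (hP : HoldsGenerically K D (fun y : Fin k → V =>
      LinearIndependent K y ∧ P (Submodule.span K (Set.range y))))
    (hD : D < Fintype.card K) (hDε : D < ε * Fintype.card K) :
    (1 - ε) * ({W : Submodule K V | Module.finrank K W = k}.ncard : ℝ) <
      ({W : Submodule K V | Module.finrank K W = k ∧ P W}.ncard : ℝ) := by
  have : Finite V := Module.finite_of_finite K
  have hX := ncard_linearIndependent_span_mem {W : Submodule K V | Module.finrank K W = k}
    fun W hW => hW
  have hG := ncard_linearIndependent_span_mem {W : Submodule K V | Module.finrank K W = k ∧ P W}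
    fun W hW => hW.1
  set N := {z : Fin k → Fin k → K | LinearIndependent K z}.ncard
  set x := {W : Submodule K V | Module.finrank K W = k}.ncard
  set g := {W : Submodule K V | Module.finrank K W = k ∧ P W}.ncard
  have hset : {y : Fin k → V | LinearIndependent K y ∧ Submodule.span K (Set.range y) ∈
      {W : Submodule K V | Module.finrank K W = k ∧ P W}} =
      {y | LinearIndependent K y ∧ P (Submodule.span K (Set.range y))} := by
    ext y
    refine ⟨fun h => ⟨h.1, h.2.2⟩, fun h => ⟨h.1, ?_, h.2⟩⟩
    rw [finrank_span_eq_card h.1, Fintype.card_fin]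
  have hle : x * N ≤ Nat.card (Fin k → V) := hX ▸ Set.ncard_le_card _
  have hcompl := Set.ncard_add_ncard_compl
    {y : Fin k → V | LinearIndependent K y ∧ P (Submodule.span K (Set.range y))}
  rw [← hset, hG, hset] at hcompl
  have hT : 0 < Nat.card (Fin k → V) := Nat.card_pos
  unfold HoldsGenerically at hP
  rw [← Set.compl_ofPred] at hP
  set T := Nat.card (Fin k → V)
  set B := {y : Fin k → V | LinearIndependent K y ∧ P (Submodule.span K (Set.range y))}ᶜ.ncard
  set Q := Fintype.card K
  have hBT : (B : ℝ) < ε * T := by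
    have h1 : (B * Q : ℝ) ≤ D * T := by exact_mod_cast hP
    have h2 : (D * T : ℝ) < ε * Q * T := by
      have : (0 : ℝ) < T := by exact_mod_cast hT
      gcongr
    have h3 : (0 : ℝ) < Q := by exact_mod_cast (by omega : 0 < Q)
    by_contra! h
    nlinarith
  have hcompl' : (g * N + B : ℝ) = T := by exact_mod_cast hcompl
  have hle' : (x * N : ℝ) ≤ T := by exact_mod_cast hle
  have hgN : 0 < g * N := by
    by_contra! h
    have h1 : B = T := by omega
    rw [h1] at hP
    nlinarith
  have hN : (0 : ℝ) < N := by exact_mod_cast Nat.pos_of_mul_pos_left hgN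
  rcases le_or_gt 1 ε with h | h
  · have hg : (0 : ℝ) < g := by exact_mod_cast Nat.pos_of_mul_pos_right hgN
    have hx : (0 : ℝ) ≤ x := Nat.cast_nonneg _
    nlinarith
  · refine lt_of_mul_lt_mul_right ?_ hN.le
    have := mul_le_mul_of_nonneg_left hle' (sub_pos.2 h).le
    nlinarith

end Counting

/-- for all `k ≥ 2`, `n ≥ k + 1`, `ε > 0`, there exists `q₀` such that
for every finite field `K` with `q₀ ≤ |K|` and every `(n, k, k)` linear ER
regeneration code with parameters `(k, k - 1, k ^ 2 - 1)` over `K` on `V`, the number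
of `k`-dimensional subspaces `Wst ⊆ V` that extend it to an `(n + 1, k, k)` linear ER
regeneration code with the same parameters exceeds `(1 - ε)` times the total number
of `k`-dimensional subspaces of `V`. -/
theorem stmt2 (k n : ℕ) (hk : 2 ≤ k) (hn : k + 1 ≤ n) (ε : ℝ) (hε : 0 < ε) :
    ∃ q₀ : ℕ, ∀ (K : Type) (_ : Field K) (_ : Fintype K), q₀ ≤ Fintype.card K →
      ∀ (V : Type) (_ : AddCommGroup V) (_ : Module K V)
        (W : Fin n → Submodule K V),
        IsERCode k k k (k - 1) (k ^ 2 - 1) W →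
        (1 - ε) * ({Wst : Submodule K V | Module.finrank K Wst = k}.ncard : ℝ) <
          ({Wst : Submodule K V | Module.finrank K Wst = k ∧
              IsERCode k k k (k - 1) (k ^ 2 - 1) (extendCode W Wst)}.ncard : ℝ) := by
  obtain ⟨m, rfl⟩ : ∃ m, k = m + 1 := ⟨k - 1, by omega⟩
  obtain ⟨q₁, hq₁⟩ := exists_nat_gt (extensionDegree m n / ε)
  refine ⟨max q₁ (extensionDegree m n + 1), fun K _ _ hq V _ _ W hW => ?_⟩
  have := hW.1
  refine (hW.holdsGenerically_extendCode (by omega) (by omega)).lt_ncard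
    ((le_max_right _ _).trans hq) ?_
  rw [div_lt_iff₀ hε] at hq₁
  have h1 : (q₁ : ℝ) ≤ Fintype.card K := by exact_mod_cast (le_max_left _ _).trans hq
  nlinarith
end

section
/- In the well-aligned setup below, almost all k-dimensional subspaces are well-aligned when the field is large: for every integer k ≥ 2 and every real ε > 0 there exists q₀ such that for every prime power q ≥ q₀, every (n,k,k) linear exact-repair regeneration code with parameters (k, k−1, k²−1) over 𝔽_q, every choice of x, A and of the data (S_j, t_j)_{j∈A} as in the setup, the number of k-dimensional subspaces of 𝓕 that are well-aligned with respect to (A;x) is greater than (1−ε) times the total number of k-dimensional subspaces of 𝓕. -/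
/-- `Wst` is well-aligned with respect to `(A; x)`, for a fixed choice of repair
subspaces `S j ⊆ W j` (`j ∈ A`) and the subspace `T`: `Wst` is spanned by `k`
vectors `w i = (∑ j ∈ A, s i j) + τ i` with `s i j ∈ S j` and `τ i ∈ T`, such that
for every `j ∈ A` one of the `s i j` vanishes and the remaining `k - 1` of them
are linearly independent. -/
def WellAligned {K : Type} [Field K] {V : Type} [AddCommGroup V] [Module K V]
    {n : ℕ} (k : ℕ) (A : Finset (Fin n))
    (S : Fin n → Submodule K V) (T : Submodule K V)
    (Wst : Submodule K V) : Prop :=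
  ∃ (w : Fin k → V) (s : Fin k → Fin n → V) (τ : Fin k → V),
    Wst = Submodule.span K (Set.range w) ∧
    (∀ (i : Fin k), ∀ j ∈ A, s i j ∈ S j) ∧
    (∀ i : Fin k, τ i ∈ T) ∧
    (∀ i : Fin k, w i = (∑ j ∈ A, s i j) + τ i) ∧
    (∀ j ∈ A, ∃ ij : Fin k, s ij j = 0 ∧
      LinearIndependent K (fun i : {i : Fin k // i ≠ ij} => s i.1 j))

section KernelMatrix

open Matrix Polynomial

variable {ι : Type*} [Fintype ι] [DecidableEq ι]

/-- The matrix whose `j`-th column is the `j`-th column of the adjugate of `N j`. When row `j` of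
`N j` vanishes, that column is the vector of signed maximal minors of the remaining rows, so it lies
in the kernel of `N j`. -/
def kernelMatrix {R : Type*} [CommRing R] (N : ι → Matrix ι ι R) : Matrix ι ι R :=
  Matrix.of fun i j => (N j).adjugate i j

theorem map_kernelMatrix {R S : Type*} [CommRing R] [CommRing S] (f : R →+* S)
    (N : ι → Matrix ι ι R) :
    f.mapMatrix (kernelMatrix N) = kernelMatrix fun j => f.mapMatrix (N j) := by
  ext i j
  simp only [kernelMatrix, ← RingHom.map_adjugate]
  rfl

theorem natDegree_det_le_card_mul {R : Type*} [CommRing R] (M : Matrix ι ι R[X]) (d : ℕ)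
    (h : ∀ i j, (M i j).natDegree ≤ d) : M.det.natDegree ≤ Fintype.card ι * d := by
  rw [Matrix.det_apply]
  refine natDegree_sum_le_of_forall_le _ _ fun σ _ => ?_
  refine (natDegree_smul_le _ _).trans ((natDegree_prod_le _ _).trans ?_)
  refine (Finset.sum_le_card_nsmul _ _ d fun i _ => h _ _).trans ?_
  simp

theorem natDegree_det_kernelMatrix_le {R : Type*} [CommRing R] (N : ι → Matrix ι ι R[X])
    (h : ∀ j r i, (N j r i).natDegree ≤ 1) :
    (kernelMatrix N).det.natDegree ≤ Fintype.card ι * Fintype.card ι := by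
  refine natDegree_det_le_card_mul _ _ fun i j => ?_
  rw [kernelMatrix, Matrix.of_apply, Matrix.adjugate_apply]
  refine (natDegree_det_le_card_mul _ 1 fun r s => ?_).trans (mul_one _).le
  rw [Matrix.updateRow_apply]
  split_ifs
  · rw [Pi.single_apply]
    split_ifs <;> simp
  · exact h _ _ _

theorem exists_polynomial_det_kernelMatrix {R : Type*} [CommRing R] (N N' : ι → Matrix ι ι R) :
    ∃ p : R[X], p.natDegree ≤ Fintype.card ι * Fintype.card ι ∧
      ∀ c, p.eval c = (kernelMatrix fun j => N j + c • N' j).det := by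
  refine ⟨(kernelMatrix fun j => Matrix.of fun r i => C (N j r i) + C (N' j r i) * X).det,
    natDegree_det_kernelMatrix_le _ fun j r i => ?_, fun c => ?_⟩
  · exact (natDegree_add_le _ _).trans (max_le (by simp)
      ((natDegree_C_mul_le _ _).trans natDegree_X_le))
  · rw [← coe_evalRingHom, RingHom.map_det, map_kernelMatrix]
    congr 2
    ext j r i
    simp only [RingHom.mapMatrix_apply, Matrix.map_apply, Matrix.of_apply, coe_evalRingHom, eval_add,
      eval_C_mul, eval_C, eval_X, Matrix.add_apply, Matrix.smul_apply, smul_eq_mul, mul_comm c]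

theorem mulVec_kernelMatrix_col {R : Type*} [CommRing R] (N : ι → Matrix ι ι R) (j : ι)
    (h : ∀ i, N j j i = 0) : N j *ᵥ (kernelMatrix N).col j = 0 := by
  have h0 : N j * (N j).adjugate = 0 := by
    rw [Matrix.mul_adjugate, Matrix.det_eq_zero_of_row_eq_zero j h, zero_smul]
  ext r
  exact congrFun (congrFun h0 r) j

variable {K : Type*} [Field K]

theorem linearIndependent_kernelMatrix_col (N : ι → Matrix ι ι K)
    (hdet : (kernelMatrix N).det ≠ 0) : LinearIndependent K (kernelMatrix N).col := by
  rw [Matrix.linearIndependent_cols_iff_isUnit, Matrix.isUnit_iff_isUnit_det]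
  exact hdet.isUnit

/-- The kernel of `N j` is spanned by column `j` of the kernel matrix. -/
theorem exists_eq_smul_kernelMatrix_col (N : ι → Matrix ι ι K) (j : ι) (h : ∀ i, N j j i = 0)
    (hdet : (kernelMatrix N).det ≠ 0) (a : ι → K) (ha : N j *ᵥ a = 0) :
    ∃ c : K, a = c • (kernelMatrix N).col j := by
  obtain ⟨i, hi⟩ : ∃ i, (kernelMatrix N).col j i ≠ 0 :=
    Function.ne_iff.1 ((linearIndependent_kernelMatrix_col N hdet).ne_zero j)
  refine ⟨a i / (kernelMatrix N).col j i, sub_eq_zero.1 ?_⟩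
  have hi' : ((N j).updateRow j (Pi.single i 1)).det ≠ 0 := by
    rwa [← Matrix.adjugate_apply]
  refine Matrix.eq_zero_of_mulVec_eq_zero hi' ?_
  have hN : N j *ᵥ (a - (a i / (kernelMatrix N).col j i) • (kernelMatrix N).col j) = 0 := by
    rw [Matrix.mulVec_sub, Matrix.mulVec_smul, ha, mulVec_kernelMatrix_col N j h]
    simp
  ext r
  by_cases hr : r = j
  · subst hr
    have hi : kernelMatrix N i r ≠ 0 := hi
    simp [Matrix.mulVec, hi]
  · have := congrFun hN r
    simpa [Matrix.mulVec, Matrix.updateRow_ne hr] using this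

theorem linearIndependent_mulVec_kernelMatrix_col (N : ι → Matrix ι ι K) (j : ι)
    (h : ∀ i, N j j i = 0) (hdet : (kernelMatrix N).det ≠ 0) :
    LinearIndependent K fun i : {i // i ≠ j} => N j *ᵥ (kernelMatrix N).col i := by
  rw [Fintype.linearIndependent_iff]
  intro a ha i
  have hsum : N j *ᵥ ∑ i : {i // i ≠ j}, a i • (kernelMatrix N).col i = 0 := by
    simpa [Matrix.mulVec_sum, Matrix.mulVec_smul] using ha
  obtain ⟨c, hc⟩ := exists_eq_smul_kernelMatrix_col N j h hdet _ hsum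
  have hli := Fintype.linearIndependent_iff.1 (linearIndependent_kernelMatrix_col N hdet)
    (fun i => if hi : i = j then -c else a ⟨i, hi⟩) (by
      rw [Fintype.sum_eq_add_sum_subtype_ne _ j, dif_pos rfl, neg_smul, neg_add_eq_zero, ← hc]
      exact Finset.sum_congr rfl fun i _ => by rw [dif_neg i.2]) i
  simpa [i.2] using hli

theorem det_kernelMatrix_diagonal {R : Type*} [CommRing R] :
    (kernelMatrix fun j : ι => Matrix.of fun r i : ι =>
      (if i = j then 0 else Pi.single i (1 : R)) r).det = 1 := by
  have : (kernelMatrix fun j : ι => Matrix.of fun r i : ι =>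
      (if i = j then 0 else Pi.single i (1 : R)) r) = 1 := by
    ext i j
    rw [kernelMatrix, Matrix.of_apply, Matrix.adjugate_apply, Matrix.one_apply]
    split_ifs with hij
    · subst hij
      rw [← Matrix.det_one (n := ι)]
      congr 1
      ext r s
      rw [Matrix.updateRow_apply, Matrix.one_apply]
      by_cases hr : r = i
      · subst hr; simp [Pi.single_apply, eq_comm]
      · by_cases hs : s = i
        · subst hs; simp [hr]
        · simp [hr, hs, Pi.single_apply]
    · refine Matrix.det_eq_zero_of_column_eq_zero j fun r => ?_
      rw [Matrix.updateRow_apply]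
      split_ifs
      · simp [Ne.symm hij]
      · simp
  rw [this, Matrix.det_one]

end KernelMatrix

section Counting

open Polynomial

/-- A function that is nonzero at `v₀` and polynomial of degree at most `d` on each line through `v₀`
has few zeros. -/
theorem card_zeros_mul_le {K E : Type*} [Field K] [Fintype K] [AddCommGroup E] [Module K E]
    [Finite E] (f : E → K) (v₀ : E) (hf : f v₀ ≠ 0) (d : ℕ)
    (hp : ∀ v, ∃ p : K[X], p.natDegree ≤ d ∧ ∀ c : K, p.eval c = f (v₀ + c • v)) :
    {v | f v = 0}.ncard * (Fintype.card K - 1) ≤ d * Nat.card E := by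
  classical
  have := Fintype.ofFinite E
  have hcol (c : K) (hc : c ≠ 0) :
      (Finset.univ.filter fun v => f (v₀ + c • v) = 0).card = {v | f v = 0}.ncard := by
    rw [Set.ncard_eq_toFinset_card']
    refine Finset.card_bij (fun v _ => v₀ + c • v) (by simp) ?_ fun w hw => ?_
    · intro v _ w _ h
      exact smul_right_injective E hc (add_left_cancel h)
    · refine ⟨c⁻¹ • (w - v₀), ?_, ?_⟩
      · simpa [smul_smul, hc] using hw
      · simp [smul_smul, hc]
  have hrow (v : E) :
      ((Finset.univ.filter fun c : K => c ≠ 0).filter fun c => f (v₀ + c • v) = 0).card ≤ d := by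
    obtain ⟨p, hpd, hpe⟩ := hp v
    have hp0 : p ≠ 0 := by
      rintro rfl
      have := hpe 0
      simp at this
      exact hf this.symm
    refine le_trans (Finset.card_le_card fun c hc => ?_)
      ((Multiset.toFinset_card_le p.roots).trans (p.card_roots'.trans hpd))
    simp only [Finset.mem_filter] at hc
    simp [hp0, hpe, hc.2]
  have hdouble := Finset.sum_card_bipartiteAbove_eq_sum_card_bipartiteBelow
    (s := Finset.univ.filter fun c : K => c ≠ 0) (t := (Finset.univ : Finset E))
    (fun c v => f (v₀ + c • v) = 0)
  simp only [Finset.bipartiteAbove, Finset.bipartiteBelow] at hdouble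
  rw [Finset.sum_congr rfl fun c hc => hcol c (Finset.mem_filter.1 hc).2, Finset.sum_const,
    smul_eq_mul, Finset.filter_ne', Finset.card_erase_of_mem (Finset.mem_univ _),
    Finset.card_univ] at hdouble
  rw [mul_comm, hdouble, ← Finset.filter_ne']
  refine (Finset.sum_le_card_nsmul _ _ d fun v _ => hrow v).trans ?_
  simp [mul_comm]

variable {K V : Type*} [Field K] [Fintype K] [AddCommGroup V] [Module K V] [Finite V]

theorem ncard_linearIndependent_span_eq_s15 {k : ℕ} (U : Submodule K V) (hU : Module.finrank K U = k) :
    {w : Fin k → V | LinearIndependent K w ∧ Submodule.span K (Set.range w) = U}.ncard =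
      ∏ i : Fin k, (Fintype.card K ^ k - Fintype.card K ^ (i : ℕ)) := by
  have h := card_linearIndependent (K := K) (V := U) (k := k) hU.ge
  rw [hU] at h
  rw [← h, ← Nat.card_coe_set_eq]
  refine (Nat.card_congr (Equiv.ofBijective
    (fun s : {s : Fin k → U // LinearIndependent K s} =>
      (⟨fun i => (s.1 i : V), s.2.map' U.subtype U.ker_subtype, ?_⟩ :
        {w : Fin k → V | LinearIndependent K w ∧ Submodule.span K (Set.range w) = U}))
    ⟨?_, ?_⟩)).symm
  · refine Submodule.eq_of_le_of_finrank_eq ?_ ?_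
    · rw [Submodule.span_le]
      rintro _ ⟨i, rfl⟩
      exact (s.1 i).2
    · rw [hU]
      exact (finrank_span_eq_card (s.2.map' U.subtype U.ker_subtype)).trans (Fintype.card_fin k)
  · intro s s' hs
    ext i
    exact congrFun (Subtype.ext_iff.1 hs) i
  · rintro ⟨w, hw, hwU⟩
    have hmem (i) : w i ∈ U := hwU ▸ Submodule.subset_span ⟨i, rfl⟩
    exact ⟨⟨fun i => ⟨w i, hmem i⟩, LinearIndependent.of_comp U.subtype hw⟩, rfl⟩

theorem ncard_subspaces_mul_eq (k : ℕ) (P : Submodule K V → Prop) :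
    {U : Submodule K V | Module.finrank K U = k ∧ P U}.ncard *
        ∏ i : Fin k, (Fintype.card K ^ k - Fintype.card K ^ (i : ℕ)) =
      {w : Fin k → V | LinearIndependent K w ∧ P (Submodule.span K (Set.range w))}.ncard := by
  classical
  have := Fintype.ofFinite (Submodule K V)
  have := Fintype.ofFinite (Fin k → V)
  rw [Set.ncard_eq_toFinset_card', Set.ncard_eq_toFinset_card',
    Finset.card_eq_sum_card_fiberwise (f := fun w : Fin k → V => Submodule.span K (Set.range w))
      (t := {U : Submodule K V | Module.finrank K U = k ∧ P U}.toFinset),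
    ← smul_eq_mul, ← Finset.sum_const]
  · refine Finset.sum_congr rfl fun U hU => ?_
    simp only [Set.mem_toFinset, Set.mem_ofPred_eq] at hU
    rw [← ncard_linearIndependent_span_eq_s15 U hU.1, Set.ncard_eq_toFinset_card']
    congr 1
    ext w
    simp only [Set.mem_toFinset, Set.mem_ofPred_eq, Finset.mem_filter]
    constructor
    · rintro ⟨hw, rfl⟩
      exact ⟨⟨hw, hU.2⟩, rfl⟩
    · rintro ⟨⟨hw, -⟩, rfl⟩
      exact ⟨hw, rfl⟩
  · intro w hw
    simp only [Set.coe_toFinset, Set.mem_ofPred_eq] at hw ⊢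
    exact ⟨(finrank_span_eq_card hw.1).trans (Fintype.card_fin k), hw.2⟩

end Counting

section WellAligned

open Matrix

variable {K V : Type} [Field K] [AddCommGroup V] [Module K V]

/-- For each `j`, the coordinates `π j` of the vectors `w i` form a matrix with columns indexed by
`i`. -/
def coordMatrix {k : ℕ} (π : Fin k → V →ₗ[K] Fin k → K) (w : Fin k → V) (j : Fin k) :
    Matrix (Fin k) (Fin k) K :=
  Matrix.of fun r i => π j (w i) r

theorem map_sum_smul_eq_coordMatrix_mulVec {k : ℕ} (π : Fin k → V →ₗ[K] Fin k → K)
    (w : Fin k → V) (j : Fin k) (a : Fin k → K) :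
    π j (∑ i, a i • w i) = coordMatrix π w j *ᵥ a := by
  ext r
  simp [coordMatrix, Matrix.mulVec, dotProduct, mul_comm]

theorem coordMatrix_add_smul {k : ℕ} (π : Fin k → V →ₗ[K] Fin k → K) (w w' : Fin k → V) (c : K)
    (j : Fin k) : coordMatrix π (w + c • w') j = coordMatrix π w j + c • coordMatrix π w' j := by
  ext r i
  simp [coordMatrix]

theorem linearIndependent_of_det_kernelMatrix_ne_zero {k : ℕ} (hk : 2 ≤ k)
    (π : Fin k → V →ₗ[K] Fin k → K) (hπ : ∀ j v, π j v j = 0) (w : Fin k → V)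
    (hdet : (kernelMatrix (coordMatrix π w)).det ≠ 0) :
    LinearIndependent K fun j => ∑ i, (kernelMatrix (coordMatrix π w)).col j i • w i := by
  rw [Fintype.linearIndependent_iff]
  intro a ha j
  have : Nontrivial (Fin k) := Fin.nontrivial_iff_two_le.2 hk
  obtain ⟨j', hj'⟩ := exists_ne j
  have hli := linearIndependent_mulVec_kernelMatrix_col (coordMatrix π w) j' (fun i => hπ _ _) hdet
  refine Fintype.linearIndependent_iff.1 hli (fun i => a i) ?_ ⟨j, hj'.symm⟩
  have h := congrArg (π j') ha
  simp only [map_sum (π j') (fun j => a j • _), map_smul, map_zero,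
    map_sum_smul_eq_coordMatrix_mulVec] at h
  rwa [Fintype.sum_eq_add_sum_subtype_ne _ j',
    mulVec_kernelMatrix_col _ _ (fun i => hπ _ _), smul_zero, zero_add] at h

variable {n k : ℕ} {A : Finset (Fin n)} {S : Fin n → Submodule K V} {T : Submodule K V}

theorem linearIndependent_and_wellAligned_of_det_ne_zero (hk : 2 ≤ k) (e : A ≃ Fin k)
    (p : Fin k → V →ₗ[K] V) (π : Fin k → V →ₗ[K] Fin k → K)
    (hp : ∀ (j : A) v, p (e j) v ∈ S j) (hT : ∀ v, v - ∑ j, p j v ∈ T)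
    (hker : ∀ j v, p j v = 0 ↔ π j v = 0) (hπ : ∀ j v, π j v j = 0) (w : Fin k → V)
    (hdet : (kernelMatrix (coordMatrix π w)).det ≠ 0) :
    LinearIndependent K w ∧ WellAligned k A S T (Submodule.span K (Set.range w)) := by
  set u : Fin k → V := fun j => ∑ i, (kernelMatrix (coordMatrix π w)).col j i • w i with hu
  have hli : LinearIndependent K u := linearIndependent_of_det_kernelMatrix_ne_zero hk π hπ w hdet
  have hle : Submodule.span K (Set.range u) ≤ Submodule.span K (Set.range w) := by
    rw [Submodule.span_le]
    rintro _ ⟨j, rfl⟩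
    exact Submodule.sum_smul_mem _ _ fun i _ => Submodule.subset_span ⟨i, rfl⟩
  have : FiniteDimensional K (Submodule.span K (Set.range w)) :=
    FiniteDimensional.span_of_finite K (Set.finite_range w)
  have hfin : Module.finrank K (Submodule.span K (Set.range w)) = k := by
    refine le_antisymm ((finrank_range_le_card w).trans (Fintype.card_fin k).le) ?_
    have := Submodule.finrank_mono hle
    rwa [finrank_span_eq_card hli, Fintype.card_fin] at this
  have hspan : Submodule.span K (Set.range w) = Submodule.span K (Set.range u) := by
    refine (Submodule.eq_of_le_of_finrank_eq hle ?_).symm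
    rw [hfin, finrank_span_eq_card hli, Fintype.card_fin]
  refine ⟨linearIndependent_iff_card_eq_finrank_span.2 ((Fintype.card_fin k).trans hfin.symm), ?_⟩
  refine ⟨u, fun i j => if h : j ∈ A then p (e ⟨j, h⟩) (u i) else 0,
    fun i => u i - ∑ j, p j (u i), hspan, fun i j hj => ?_, fun i => hT _, fun i => ?_,
    fun j hj => ⟨e ⟨j, hj⟩, ?_, ?_⟩⟩
  · simp only [dif_pos hj]
    exact hp ⟨j, hj⟩ _
  · beta_reduce
    rw [← Finset.sum_coe_sort A, ← e.sum_comp]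
    simp
  · beta_reduce
    rw [dif_pos hj, hker, hu, map_sum_smul_eq_coordMatrix_mulVec]
    exact mulVec_kernelMatrix_col _ _ fun i => hπ _ _
  · simp only [dif_pos hj]
    have h := linearIndependent_mulVec_kernelMatrix_col (coordMatrix π w) (e ⟨j, hj⟩)
      (fun i => hπ _ _) hdet
    rw [Fintype.linearIndependent_iff] at h ⊢
    intro a ha
    refine h a ?_
    simp only [← map_sum_smul_eq_coordMatrix_mulVec, ← map_smul, ← map_sum] at ha ⊢
    exact (hker _ _).1 ha

theorem finrank_span_image_add_one_le {ι : Type*} [DecidableEq ι] (A : Finset ι) (hA : A.Nonempty)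
    (t : ι → V) (ht : ∑ j ∈ A, t j = 0) :
    Module.finrank K (Submodule.span K (t '' (A : Set ι))) + 1 ≤ A.card := by
  classical
  obtain ⟨x, hx⟩ := hA
  have hspan : Submodule.span K (t '' (A : Set ι)) ≤
      Submodule.span K ((A.erase x).image t : Finset V) := by
    rw [Submodule.span_le]
    have hmem (j) (hj : j ∈ A.erase x) :
        t j ∈ Submodule.span K ((A.erase x).image t : Finset V) :=
      Submodule.subset_span (Finset.mem_coe.2 (Finset.mem_image_of_mem t hj))
    rintro _ ⟨j, hj, rfl⟩
    by_cases hjx : j = x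
    · subst hjx
      rw [← Finset.add_sum_erase A t hx, add_eq_zero_iff_eq_neg] at ht
      rw [ht]
      exact neg_mem (sum_mem hmem)
    · exact hmem j (Finset.mem_erase.2 ⟨hjx, hj⟩)
  have h1 := Submodule.finrank_mono hspan
  have h2 := finrank_span_finset_le_card (R := K) ((A.erase x).image t)
  have h3 := Finset.card_image_le (s := A.erase x) (f := t)
  have h4 := Finset.card_erase_add_one hx
  unfold Set.finrank at h2
  omega

/-- If the `S j` and `T` span `V` and their dimensions add up to at most `dim V`, then `V` is their
direct sum, which provides projections onto the `S j` and coordinates on them. -/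
theorem exists_projections_coordinates [FiniteDimensional K V] (e : A ≃ Fin k)
    (hS : ∀ j ∈ A, Module.finrank K (S j) = k - 1) (htop : (∑ j ∈ A, S j) ⊔ T = ⊤)
    (hdim : k * (k - 1) + Module.finrank K T ≤ Module.finrank K V) :
    ∃ (p : Fin k → V →ₗ[K] V) (π : Fin k → V →ₗ[K] Fin k → K) (w : Fin k → V),
      (∀ (j : A) v, p (e j) v ∈ S j) ∧ (∀ v, v - ∑ j, p j v ∈ T) ∧
      (∀ j v, p j v = 0 ↔ π j v = 0) ∧ (∀ j v, π j v j = 0) ∧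
      ∀ j i, π j (w i) = if i = j then 0 else Pi.single i 1 := by
  let f : ((∀ j : Fin k, S (e.symm j)) × T) →ₗ[K] V :=
    (LinearMap.lsum K (fun j : Fin k => S (e.symm j)) K fun j => (S (e.symm j)).subtype).coprod
      T.subtype
  have hf (y) : f y = ∑ j, (y.1 j : V) + y.2 := by
    simp [f]
  have hsurj : Function.Surjective f := by
    rw [← LinearMap.range_eq_top, eq_top_iff, ← htop, sup_le_iff]
    refine ⟨?_, fun v hv => ⟨(0, ⟨v, hv⟩), by simp [hf]⟩⟩
    refine Finset.sum_induction _ (· ≤ LinearMap.range f) (fun _ _ => sup_le) bot_le fun j hj => ?_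
    intro v hv
    refine ⟨(Pi.single (e ⟨j, hj⟩) ⟨v, by simpa using hv⟩, 0), ?_⟩
    rw [hf, Finset.sum_eq_single (e ⟨j, hj⟩)]
    · simp
    · intro i _ hi
      simp [Pi.single_eq_of_ne hi]
    · simp
  have hrank : Module.finrank K ((∀ j : Fin k, S (e.symm j)) × T) = Module.finrank K V := by
    refine le_antisymm ?_ (LinearMap.finrank_le_finrank_of_surjective hsurj)
    rw [Module.finrank_prod, Module.finrank_pi_fintype,
      Finset.sum_congr rfl fun j _ => hS _ (e.symm j).2]
    simpa using hdim
  have hinj : Function.Injective f :=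
    (LinearMap.injective_iff_surjective_of_finrank_eq_finrank hrank).2 hsurj
  let Φ := LinearEquiv.ofBijective f ⟨hinj, hsurj⟩
  have hb (j : Fin k) : Nonempty (Module.Basis {r // r ≠ j} K (S (e.symm j))) := by
    refine ⟨Module.Basis.reindex (Module.finBasisOfFinrankEq K _ (hS _ (e.symm j).2)) ?_⟩
    exact Fintype.equivOfCardEq (by simp)
  have b := fun j => (hb j).some
  let q (j : Fin k) : V →ₗ[K] S (e.symm j) :=
    LinearMap.proj j ∘ₗ LinearMap.fst K (∀ j : Fin k, S (e.symm j)) T ∘ₗ Φ.symm.toLinearMap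
  have hq (j y) : q j (Φ y) = y.1 j := by simp [q]
  let extendZero (j : Fin k) : ({r // r ≠ j} → K) →ₗ[K] Fin k → K :=
    LinearMap.pi fun r => if h : r ≠ j then LinearMap.proj ⟨r, h⟩ else 0
  have hext (j) (g : {r // r ≠ j} → K) (r) :
      extendZero j g r = if h : r ≠ j then g ⟨r, h⟩ else 0 := by
    simp only [extendZero, LinearMap.pi_apply]
    split_ifs <;> simp
  refine ⟨fun j => (S (e.symm j)).subtype ∘ₗ q j,
    fun j => extendZero j ∘ₗ (b j).equivFun.toLinearMap ∘ₗ q j,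
    fun i => Φ (fun j => if h : i ≠ j then b j ⟨i, h⟩ else 0, 0), ?_, ?_, ?_, ?_, ?_⟩
  · intro j v
    have := (q (e j) v).2
    simpa using this
  · intro v
    obtain ⟨y, rfl⟩ := Φ.surjective v
    simp only [LinearMap.comp_apply, hq, Submodule.subtype_apply]
    have : Φ y = ∑ j, (y.1 j : V) + y.2 := hf y
    rw [this, add_sub_cancel_left]
    exact y.2.2
  · intro j v
    have hinj : Function.Injective (extendZero j) := by
      intro g g' h
      ext r
      have := congrFun h r
      rwa [hext, hext, dif_pos r.2, dif_pos r.2] at this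
    simp only [LinearMap.comp_apply, Submodule.subtype_apply, Submodule.coe_eq_zero,
      LinearEquiv.coe_coe, map_eq_zero_iff _ hinj, map_eq_zero_iff _ (b j).equivFun.injective]
  · intro j v
    simp [hext]
  · intro j i
    ext r
    simp only [LinearMap.comp_apply, hq, hext, LinearEquiv.coe_coe]
    by_cases hij : i = j
    · simp [hij]
    · simp only [dif_pos hij, if_neg hij, Module.Basis.equivFun_self, Pi.single_apply]
      by_cases hr : r = j
      · simp [hr, Ne.symm hij]
      · simp [hr, Subtype.ext_iff, eq_comm]

end WellAligned

/-- If the number of zeros `z` among `E` points satisfies `z * q ≤ d * E`, and classes of size `g`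
cover all nonzeros by `good` out of `total` classes, then most classes are good. -/
theorem one_sub_mul_lt_of_zeros_mul_le {ε total good g z E d q : ℝ} (hq : 0 < q)
    (hdq : d ≤ q) (hdε : d < ε * q) (hg : 0 < g) (hgood : 0 < good)
    (htotal : total * g ≤ E) (hle : good ≤ total) (hz : z * q ≤ d * E) (hE : E - z ≤ good * g) :
    (1 - ε) * total < good := by
  have h1 : (q - d) * (total * g) ≤ good * g * q := by nlinarith
  have h2 : (q - d) * total ≤ good * q := by
    refine le_of_mul_le_mul_right ?_ hg
    linarith
  have h3 : 0 < total := hgood.trans_le hle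
  refine lt_of_mul_lt_mul_right (a := q) ?_ hq.le
  nlinarith

/-- for every `k ≥ 2` and `ε > 0` there is `q₀` such that over every
finite field `K` with `q₀ ≤ |K|`, for every `(n, k, k)` linear ER regeneration code
with parameters `(k, k - 1, k ^ 2 - 1)` and every choice of `x`, `A` and repair data
`(S j, t j)` as in the well-aligned setup, the number of `k`-dimensional subspaces of
the ambient space that are well-aligned with respect to `(A; x)` exceeds `(1 - ε)`
times the total number of `k`-dimensional subspaces. -/
theorem stmt15 (k : ℕ) (hk : 2 ≤ k) (ε : ℝ) (hε : 0 < ε) :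
    ∃ q₀ : ℕ, ∀ (K : Type) (_ : Field K) (_ : Fintype K), q₀ ≤ Fintype.card K →
      ∀ (n : ℕ), k + 1 ≤ n →
      ∀ (V : Type) (_ : AddCommGroup V) (_ : Module K V)
        (W : Fin n → Submodule K V),
        IsERCode k k k (k - 1) (k ^ 2 - 1) W →
        ∀ (x : Fin n) (A : Finset (Fin n)), x ∉ A → A.card = k →
        ∀ S : Fin n → Submodule K V,
          (∀ j ∈ A, S j ≤ W j) →
          (∀ j ∈ A, Module.finrank K (S j) = k - 1) →
          W x ≤ ∑ j ∈ A, S j →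
        ∀ t : Fin n → V,
          (∀ j ∈ A, t j ≠ 0) → (∀ j ∈ A, t j ∈ W j) →
          (∑ j ∈ A, t j = 0) →
          (∀ j ∈ A, Disjoint (S j) (Submodule.span K {t j}) ∧
            S j ⊔ Submodule.span K {t j} = W j) →
        (1 - ε) * ({Wst : Submodule K V | Module.finrank K Wst = k}.ncard : ℝ) <
          ({Wst : Submodule K V | Module.finrank K Wst = k ∧
              WellAligned k A S (Submodule.span K (t '' ↑A)) Wst}.ncard : ℝ) := by
  refine ⟨k * k + ⌈(k * k : ℝ) / ε⌉₊ + 2, ?_⟩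
  intro K _ _ hq n _ V _ _ W ⟨_, hV, _, hW, _⟩ x A _ hA S _ hS _ t _ _ ht hWS
  have := Module.finite_of_finite K (M := V)
  set T := Submodule.span K (t '' (A : Set (Fin n))) with hT
  have hAne : A.Nonempty := Finset.card_pos.1 (by omega)
  have htop : (∑ j ∈ A, S j) ⊔ T = ⊤ := by
    rw [eq_top_iff, ← hW A hA]
    refine Finset.sum_induction _ (· ≤ (∑ j ∈ A, S j) ⊔ T) (fun _ _ => sup_le) bot_le fun j hj => ?_
    rw [← (hWS j hj).2]
    refine sup_le_sup (Finset.single_le_sum_of_canonicallyOrdered hj) (Submodule.span_mono ?_)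
    exact Set.singleton_subset_iff.2 ⟨j, hj, rfl⟩
  have hTdim := finrank_span_image_add_one_le (K := K) A hAne t ht
  rw [← hT, hA] at hTdim
  have hdim : k * (k - 1) + Module.finrank K T ≤ Module.finrank K V := by
    obtain ⟨m, rfl⟩ := Nat.exists_eq_add_of_le' (by omega : 1 ≤ k)
    have hsq : (m + 1) ^ 2 - 1 = (m + 1) * m + m := by
      rw [show (m + 1) ^ 2 = (m + 1) * m + m + 1 by ring, Nat.add_sub_cancel]
    rw [hV, hsq, Nat.add_sub_cancel]
    omega
  have e : A ≃ Fin k := Finset.equivFinOfCardEq hA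
  obtain ⟨p, π, w₀, hp, hpT, hker, hπ, hw₀⟩ := exists_projections_coordinates e hS htop hdim
  have hdet₀ : (kernelMatrix (coordMatrix π w₀)).det ≠ 0 := by
    have : coordMatrix π w₀ = fun j => Matrix.of fun r i =>
        (if i = j then 0 else Pi.single i (1 : K)) r := by
      ext j r i
      simp only [coordMatrix, Matrix.of_apply, hw₀]
    rw [this, det_kernelMatrix_diagonal]
    exact one_ne_zero
  have hgood := linearIndependent_and_wellAligned_of_det_ne_zero hk e p π hp hpT hker hπ
  have hz := card_zeros_mul_le (fun w => (kernelMatrix (coordMatrix π w)).det) w₀ hdet₀ (k * k)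
    fun w => by
      obtain ⟨P, hP, hPe⟩ :=
        exists_polynomial_det_kernelMatrix (coordMatrix π w₀) (coordMatrix π w)
      refine ⟨P, by simpa using hP, fun c => (hPe c).trans ?_⟩
      simp only [← coordMatrix_add_smul]
  set g := ∏ i : Fin k, (Fintype.card K ^ k - Fintype.card K ^ (i : ℕ)) with hg
  have htotal := ncard_subspaces_mul_eq (K := K) (V := V) k fun _ => True
  have hWA := ncard_subspaces_mul_eq (K := K) (V := V) k (WellAligned k A S T)
  rw [← hg] at htotal hWA
  simp only [and_true] at htotal
  have hE : Nat.card (Fin k → V) ≤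
      {w : Fin k → V | LinearIndependent K w ∧
        WellAligned k A S T (Submodule.span K (Set.range w))}.ncard +
      {w : Fin k → V | (kernelMatrix (coordMatrix π w)).det = 0}.ncard := by
    rw [← Set.ncard_univ]
    refine (Set.ncard_le_ncard fun w _ => ?_).trans (Set.ncard_union_le _ _)
    by_cases hw : (kernelMatrix (coordMatrix π w)).det = 0
    · exact Or.inr hw
    · exact Or.inl (hgood w hw)
  rw [← hWA] at hE
  have htotal' := htotal.le.trans
    ((Set.ncard_le_ncard (Set.subset_univ _)).trans_eq (Set.ncard_univ _))
  have hg0 : 0 < g := Finset.prod_pos fun i _ =>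
    Nat.sub_pos_of_lt (Nat.pow_lt_pow_right Fintype.one_lt_card i.2)
  have hpos : 0 < {U : Submodule K V | Module.finrank K U = k ∧ WellAligned k A S T U}.ncard := by
    refine (Set.ncard_pos (Set.toFinite _)).2 ⟨Submodule.span K (Set.range w₀), ?_,
      (hgood w₀ hdet₀).2⟩
    exact (finrank_span_eq_card (hgood w₀ hdet₀).1).trans (Fintype.card_fin k)
  have hle : {U : Submodule K V | Module.finrank K U = k ∧ WellAligned k A S T U}.ncard ≤
      {U : Submodule K V | Module.finrank K U = k}.ncard :=
    Set.ncard_le_ncard fun U hU => hU.1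
  have hceil := Nat.le_ceil ((k * k : ℝ) / ε)
  obtain ⟨q, hq'⟩ := Nat.exists_eq_add_of_le' (Fintype.card_pos : 0 < Fintype.card K)
  rw [hq'] at hq hz
  have hq1 : ((k * k + ⌈(k * k : ℝ) / ε⌉₊ + 1 : ℕ) : ℝ) ≤ q := by
    exact_mod_cast (by omega : k * k + ⌈(k * k : ℝ) / ε⌉₊ + 1 ≤ q)
  push_cast at hq1
  have hkk : (0 : ℝ) ≤ k * k := by positivity
  have hceil0 : (0 : ℝ) ≤ (⌈(k * k : ℝ) / ε⌉₊ : ℝ) := Nat.cast_nonneg _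
  refine one_sub_mul_lt_of_zeros_mul_le (d := k * k) (q := q) (g := g)
    (E := Nat.card (Fin k → V))
    (z := {w : Fin k → V | (kernelMatrix (coordMatrix π w)).det = 0}.ncard)
    (by linarith) (by linarith) ?_ (by exact_mod_cast hg0) (by exact_mod_cast hpos)
    (by exact_mod_cast htotal') (by exact_mod_cast hle) (by exact_mod_cast hz) ?_
  · rw [← div_lt_iff₀' hε]
    linarith
  · rw [sub_le_iff_le_add]
    exact_mod_cast hE
end
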